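/- arXiv:1511.07947 — 3 statements merged into one kernel-verified Lean document; each statement's English description precedes it below -/
import Mathlib

section
/- 24·F₃(√−15/6 + 1/2) − 8·F₃(√−15/2 + 1/2) − 3·F₃(√−15/3) + F₃(√−15) = π³/√15 − 7ζ(3), where √−15 denotes i√15. -/
open scoped Real

/-- `F₃(τ) = Σ_{m≥1} Σ_{n≥1} e^{2πimnτ}/n³`. -/
noncomputable def F₃ (τ : ℂ) : ℂ :=
  ∑' m : ℕ, ∑' n : ℕ,
    Complex.exp (2 * Real.pi * Complex.I * ((m : ℂ) + 1) * ((n : ℂ) + 1) * τ) / ((n : ℂ) + 1) ^ 3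

/-- The geometric series `Σ_{m≥1} e^{2πimz}` in closed form. -/
noncomputable def lambertTerm (z : ℂ) : ℂ :=
  Complex.exp (2 * π * Complex.I * z) / (1 - Complex.exp (2 * π * Complex.I * z))

lemma norm_exp_two_pi_I_mul_lt_one {z : ℂ} (hz : 0 < z.im) :
    ‖Complex.exp (2 * π * Complex.I * z)‖ < 1 :=
  UpperHalfPlane.norm_exp_two_pi_I_lt_one ⟨z, hz⟩

lemma lambertTerm_add_intCast (z : ℂ) (k : ℤ) : lambertTerm (z + k) = lambertTerm z := by
  have h : Complex.exp (2 * π * Complex.I * (z + k)) = Complex.exp (2 * π * Complex.I * z) := by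
    rw [Complex.exp_eq_exp_iff_exists_int]
    exact ⟨k, by ring⟩
  simp only [lambertTerm, h]

lemma summable_exp_div_cube {τ : ℂ} (hτ : 0 < τ.im) :
    Summable fun p : ℕ × ℕ ↦
      Complex.exp (2 * π * Complex.I * ((p.1 : ℂ) + 1) * ((p.2 : ℂ) + 1) * τ) /
        ((p.2 : ℂ) + 1) ^ 3 := by
  set q := Complex.exp (2 * π * Complex.I * τ) with hq
  have hq1 : ‖q‖ < 1 := norm_exp_two_pi_I_mul_lt_one hτ
  have h1 : Summable fun m : ℕ ↦ ‖q‖ ^ m := summable_geometric_of_lt_one (norm_nonneg _) hq1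
  have h2 : Summable fun n : ℕ ↦ 1 / ((n : ℝ) + 1) ^ 3 := by
    have := (summable_nat_add_iff 1).mpr (Real.summable_one_div_nat_pow.mpr (by norm_num : 1 < 3))
    exact_mod_cast this
  refine Summable.of_norm_bounded
    (h1.mul_of_nonneg h2 (fun _ ↦ by positivity) (fun _ ↦ by positivity)) fun p ↦ ?_
  have e : Complex.exp (2 * π * Complex.I * ((p.1 : ℂ) + 1) * ((p.2 : ℂ) + 1) * τ) =
      q ^ ((p.1 + 1) * (p.2 + 1)) := by
    rw [hq, ← Complex.exp_nat_mul]
    push_cast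
    ring_nf
  have hn : ‖((p.2 : ℂ) + 1) ^ 3‖ = ((p.2 : ℝ) + 1) ^ 3 := by
    rw [norm_pow]
    norm_cast
  rw [e, norm_div, hn, norm_pow, div_eq_mul_one_div]
  gcongr ?_ * _
  exact pow_le_pow_of_le_one (norm_nonneg _) hq1.le (by nlinarith)

lemma hasSum_lambertTerm {z : ℂ} (hz : 0 < z.im) :
    HasSum (fun m : ℕ ↦ Complex.exp (2 * π * Complex.I * ((m : ℂ) + 1) * z)) (lambertTerm z) := by
  have h := (hasSum_geometric_of_norm_lt_one (norm_exp_two_pi_I_mul_lt_one hz)).mul_left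
    (Complex.exp (2 * π * Complex.I * z))
  convert! h using 1
  ext m
  rw [← Complex.exp_nat_mul, ← Complex.exp_add]
  ring_nf

lemma hasSum_F₃_succ {τ : ℂ} (hτ : 0 < τ.im) :
    HasSum (fun n : ℕ ↦ lambertTerm (((n : ℂ) + 1) * τ) / ((n : ℂ) + 1) ^ 3) (F₃ τ) := by
  have hs := summable_exp_div_cube hτ
  have hF : F₃ τ = ∑' p : ℕ × ℕ,
      Complex.exp (2 * π * Complex.I * ((p.1 : ℂ) + 1) * ((p.2 : ℂ) + 1) * τ) /
        ((p.2 : ℂ) + 1) ^ 3 := hs.tsum_prod.symm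
  rw [hF, ← (Equiv.prodComm ℕ ℕ).tsum_eq]
  refine HasSum.prod_fiberwise ((Equiv.prodComm ℕ ℕ).summable_iff.mpr hs).hasSum fun n ↦ ?_
  have hn : 0 < (((n : ℂ) + 1) * τ).im := by
    have : (((n : ℂ) + 1) * τ).im = ((n : ℝ) + 1) * τ.im := by simp
    rw [this]
    positivity
  refine ((hasSum_lambertTerm hn).div_const (((n : ℂ) + 1) ^ 3)).congr_fun ?_
  intro m
  simp [mul_assoc]

lemma hasSum_F₃ {τ : ℂ} (hτ : 0 < τ.im) :
    HasSum (fun n : ℕ ↦ lambertTerm (n * τ) / (n : ℂ) ^ 3) (F₃ τ) := by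
  rw [← hasSum_nat_add_iff' 1]
  simpa using hasSum_F₃_succ hτ

lemma F₃_add_intCast {τ : ℂ} (hτ : 0 < τ.im) (k : ℤ) : F₃ (τ + k) = F₃ τ := by
  refine (hasSum_F₃ (τ := τ + k) (by simpa using hτ)).unique ?_
  convert! hasSum_F₃ hτ using 3 with n
  rw [← lambertTerm_add_intCast (n * τ) (n * k)]
  push_cast
  ring_nf

lemma lambertTerm_half_add_half {z : ℂ} (hz : 0 < z.im) :
    lambertTerm (z / 2) + lambertTerm (z / 2 + 1 / 2) = 2 * lambertTerm z := by
  set w := Complex.exp (2 * π * Complex.I * (z / 2)) with hw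
  have h1 : Complex.exp (2 * π * Complex.I * (z / 2 + 1 / 2)) = -w := by
    rw [show 2 * π * Complex.I * (z / 2 + 1 / 2) =
      2 * π * Complex.I * (z / 2) + π * Complex.I by ring, Complex.exp_add, Complex.exp_pi_mul_I]
    ring
  have h2 : Complex.exp (2 * π * Complex.I * z) = w ^ 2 := by
    rw [hw, ← Complex.exp_nat_mul]
    push_cast
    ring_nf
  have h3 : w ^ 2 ≠ 1 := by
    intro h
    have := norm_exp_two_pi_I_mul_lt_one hz
    rw [h2, h] at this
    simp at this
  have h4 : 1 - w ≠ 0 := fun h ↦ h3 (by linear_combination (-1 - w) * h)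
  have h5 : 1 + w ≠ 0 := fun h ↦ h3 (by linear_combination (w - 1) * h)
  have h6 : 1 - w ^ 2 ≠ 0 := fun h ↦ h3 (by linear_combination -h)
  simp only [lambertTerm, ← hw, h1, h2]
  rw [sub_neg_eq_add]
  field_simp
  ring

/-- The Hecke relation at `2` for `F₃`. -/
lemma F₃_half_add_F₃_half {τ : ℂ} (hτ : 0 < τ.im) :
    F₃ (τ / 2) + F₃ (τ / 2 + 1 / 2) = 9 / 4 * F₃ τ - 1 / 4 * F₃ (2 * τ) := by
  have hh : 0 < (τ / 2).im := by simpa using hτ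
  have hh' : 0 < (τ / 2 + 1 / 2).im := by
    have : (τ / 2 + 1 / 2).im = (τ / 2).im := by simp
    rwa [this]
  have hd : 0 < (2 * τ).im := by simpa using hτ
  set a : ℕ → ℂ := fun n ↦ lambertTerm (n * τ) / (n : ℂ) ^ 3 with ha
  have hsum : HasSum a (F₃ τ) := hasSum_F₃ hτ
  have heven : HasSum (fun k ↦ a (2 * k)) (F₃ (2 * τ) / 8) := by
    convert! (hasSum_F₃ hd).div_const 8 using 2 with k
    simp only [ha]
    push_cast
    rw [mul_pow, div_div]
    ring_nf
  have hodd : HasSum (fun k ↦ a (2 * k + 1)) (F₃ τ - F₃ (2 * τ) / 8) := by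
    have hs : Summable fun k ↦ a (2 * k + 1) :=
      hsum.summable.comp_injective (i := fun k ↦ 2 * k + 1) fun x y h ↦ by
        simp only at h
        lia
    have := (heven.even_add_odd hs.hasSum).unique hsum
    rw [← this]
    simpa using hs.hasSum
  refine ((hasSum_F₃ hh).add (hasSum_F₃ hh')).unique ?_
  have key := HasSum.even_add_odd
    (f := fun n : ℕ ↦ lambertTerm (n * (τ / 2)) / (n : ℂ) ^ 3 +
      lambertTerm (n * (τ / 2 + 1 / 2)) / (n : ℂ) ^ 3)
    (m := F₃ τ / 4) (m' := 2 * (F₃ τ - F₃ (2 * τ) / 8)) ?_ ?_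
  · convert! key using 1
    ring
  · convert! hsum.div_const 4 using 2 with k
    have e : ((2 * k : ℕ) : ℂ) * (τ / 2 + 1 / 2) = k * τ + (k : ℤ) := by push_cast; ring
    have e' : ((2 * k : ℕ) : ℂ) * (τ / 2) = k * τ := by push_cast; ring
    rw [e, e', lambertTerm_add_intCast]
    simp only [ha]
    push_cast
    rw [mul_pow]
    ring
  · convert! hodd.mul_left 2 using 2 with k
    have e : ((2 * k + 1 : ℕ) : ℂ) * (τ / 2 + 1 / 2) =
      (((2 * k + 1 : ℕ) : ℂ) * τ) / 2 + 1 / 2 + (k : ℤ) := by push_cast; ring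
    have e' : ((2 * k + 1 : ℕ) : ℂ) * (τ / 2) = (((2 * k + 1 : ℕ) : ℂ) * τ) / 2 := by ring
    have him : 0 < (((2 * k + 1 : ℕ) : ℂ) * τ).im := by
      rw [← Complex.ofReal_natCast, Complex.im_ofReal_mul]
      positivity
    rw [e, e', lambertTerm_add_intCast, ← add_div, lambertTerm_half_add_half him]
    simp only [ha]
    ring

/-- The kernel `1 / (n²τ² - m²)`, with `n, m ≥ 1` shifted
to start at `0`. -/
noncomputable def cotKernel (τ : ℂ) (n m : ℕ) : ℂ :=
  1 / ((((n : ℂ) + 1) * τ) ^ 2 - ((m : ℂ) + 1) ^ 2)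

lemma lambertTerm_eq_cot_series {z : ℂ} (hz : 0 < z.im) :
    lambertTerm z = -1 / 2 + Complex.I / (2 * π) *
      (1 / z + 2 * z * ∑' m : ℕ, 1 / (z ^ 2 - ((m : ℂ) + 1) ^ 2)) := by
  have hzc : z ∈ Complex.integerComplement := UpperHalfPlane.coe_mem_integerComplement ⟨z, hz⟩
  have h := cot_series_rep' hzc
  have h' : ∑' n : ℕ, (1 / (z - ((n : ℂ) + 1)) + 1 / (z + ((n : ℂ) + 1))) =
      2 * z * ∑' m : ℕ, 1 / (z ^ 2 - ((m : ℂ) + 1) ^ 2) := by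
    rw [← tsum_mul_left]
    refine tsum_congr fun m ↦ (cotTerm_identity hzc m).trans ?_
    ring_nf
  rw [h', Complex.cot_pi_eq_exp_ratio] at h
  have hne : 1 - Complex.exp (2 * π * Complex.I * z) ≠ 0 := by
    intro h0
    have := norm_exp_two_pi_I_mul_lt_one hz
    rw [← sub_eq_zero.mp h0] at this
    simp at this
  have hpi : (π : ℂ) ≠ 0 := by exact_mod_cast Real.pi_ne_zero
  rw [← h, lambertTerm]
  generalize Complex.exp (2 * π * Complex.I * z) = w at hne ⊢
  rw [add_sub_cancel]
  field_simp
  ring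

lemma cotKernel_norm_le {τ : ℂ} (hτ : 0 < τ.im) (n m : ℕ) :
    ‖cotKernel τ n m‖ ≤ 1 / τ.im ^ 2 * (1 / ((n : ℝ) + 1) ^ 2) := by
  have hfac : (((n : ℂ) + 1) * τ) ^ 2 - ((m : ℂ) + 1) ^ 2 =
      (((n : ℂ) + 1) * τ - ((m : ℂ) + 1)) * (((n : ℂ) + 1) * τ + ((m : ℂ) + 1)) := by ring
  have h1 : ((n : ℝ) + 1) * τ.im ≤ ‖((n : ℂ) + 1) * τ - ((m : ℂ) + 1)‖ := by
    refine le_trans (le_of_eq ?_) ((le_abs_self _).trans (Complex.abs_im_le_norm _))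
    simp
  have h2 : ((n : ℝ) + 1) * τ.im ≤ ‖((n : ℂ) + 1) * τ + ((m : ℂ) + 1)‖ := by
    refine le_trans (le_of_eq ?_) ((le_abs_self _).trans (Complex.abs_im_le_norm _))
    simp
  rw [cotKernel, hfac, norm_div, norm_one, norm_mul, one_div_mul_one_div]
  refine one_div_le_one_div_of_le (by positivity) ?_
  calc τ.im ^ 2 * ((n : ℝ) + 1) ^ 2 = (((n : ℝ) + 1) * τ.im) * (((n : ℝ) + 1) * τ.im) := by ring
    _ ≤ _ := mul_le_mul h1 h2 (by positivity) (norm_nonneg _)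

lemma neg_one_div_im_pos {τ : ℂ} (hτ : 0 < τ.im) : 0 < (-1 / τ).im := by
  have h0 : τ ≠ 0 := fun h ↦ by simp [h] at hτ
  have : (-1 / τ).im = τ.im / Complex.normSq τ := by simp [neg_div, Complex.inv_im]
  rw [this]
  exact div_pos hτ (Complex.normSq_pos.mpr h0)

lemma cotKernel_neg_one_div {τ : ℂ} (hτ : 0 < τ.im) (n m : ℕ) :
    cotKernel (-1 / τ) n m = -τ ^ 2 * cotKernel τ m n := by
  have h0 : τ ≠ 0 := fun h ↦ by simp [h] at hτ
  have e : (((n : ℂ) + 1) * (-1 / τ)) ^ 2 - ((m : ℂ) + 1) ^ 2 =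
      ((((m : ℂ) + 1) * τ) ^ 2 - ((n : ℂ) + 1) ^ 2) / (-τ ^ 2) := by
    field_simp
    ring
  rw [cotKernel, cotKernel, e, one_div_div]
  ring

lemma summable_one_div_add_one_sq : Summable fun n : ℕ ↦ 1 / ((n : ℝ) + 1) ^ 2 := by
  have := (summable_nat_add_iff 1).mpr (Real.summable_one_div_nat_pow.mpr (by norm_num : 1 < 2))
  exact_mod_cast this

lemma norm_natCast_add_one (n : ℕ) : ‖(n : ℂ) + 1‖ = (n : ℝ) + 1 := by
  norm_cast

lemma summable_cotKernel_div_snd {τ : ℂ} (hτ : 0 < τ.im) :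
    Summable fun p : ℕ × ℕ ↦ cotKernel τ p.1 p.2 / ((p.2 : ℂ) + 1) ^ 2 := by
  refine Summable.of_norm_bounded
    ((summable_one_div_add_one_sq.mul_of_nonneg summable_one_div_add_one_sq
      (fun _ ↦ by positivity) (fun _ ↦ by positivity)).mul_left (1 / τ.im ^ 2)) fun p ↦ ?_
  rw [norm_div, norm_pow, norm_natCast_add_one, div_eq_mul_one_div, ← mul_assoc]
  gcongr
  exact cotKernel_norm_le hτ _ _

lemma summable_cotKernel_div_fst {τ : ℂ} (hτ : 0 < τ.im) :
    Summable fun p : ℕ × ℕ ↦ cotKernel τ p.1 p.2 / ((p.1 : ℂ) + 1) ^ 2 := by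
  have h0 : τ ≠ 0 := fun h ↦ by simp [h] at hτ
  have h := (Equiv.prodComm ℕ ℕ).summable_iff.mpr
    (summable_cotKernel_div_snd (neg_one_div_im_pos hτ))
  convert! h.mul_left (-1 / τ ^ 2) using 2 with p
  simp only [Function.comp_apply, Equiv.prodComm_apply, Prod.fst_swap, Prod.snd_swap,
    cotKernel_neg_one_div hτ]
  field_simp

lemma hasSum_one_div_add_one_cube :
    HasSum (fun n : ℕ ↦ 1 / ((n : ℂ) + 1) ^ 3) (riemannZeta 3) := by
  have hs : Summable fun n : ℕ ↦ 1 / (n : ℂ) ^ 3 := by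
    have := Complex.ofRealCLM.summable (Real.summable_one_div_nat_pow.mpr (by norm_num : 1 < 3))
    simpa using this
  have h := hs.hasSum
  have hz := zeta_nat_eq_tsum_of_gt_one (k := 3) (by norm_num)
  rw [← hz, ← hasSum_nat_add_iff' 1] at h
  simpa using h

lemma hasSum_one_div_add_one_sq :
    HasSum (fun n : ℕ ↦ 1 / ((n : ℂ) + 1) ^ 2) ((π : ℂ) ^ 2 / 6) := by
  have h := Complex.hasSum_ofReal.mpr hasSum_zeta_two
  rw [← hasSum_nat_add_iff' 1] at h
  simpa using h

lemma hasSum_one_div_add_one_pow_four :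
    HasSum (fun n : ℕ ↦ 1 / ((n : ℂ) + 1) ^ 4) ((π : ℂ) ^ 4 / 90) := by
  have h := Complex.hasSum_ofReal.mpr hasSum_zeta_four
  rw [← hasSum_nat_add_iff' 1] at h
  simpa using h

/-- `F₃` as an absolutely convergent lattice sum, from the partial fractions of the cotangent. -/
lemma F₃_eq_tsum_cotKernel {τ : ℂ} (hτ : 0 < τ.im) :
    F₃ τ = -riemannZeta 3 / 2 + Complex.I / (2 * π) * ((π : ℂ) ^ 4 / 90 / τ +
      2 * τ * ∑' p : ℕ × ℕ, cotKernel τ p.1 p.2 / ((p.1 : ℂ) + 1) ^ 2) := by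
  have h0 : τ ≠ 0 := fun h ↦ by simp [h] at hτ
  have hs := summable_cotKernel_div_fst hτ
  have h1 : HasSum (fun n : ℕ ↦ ∑' m : ℕ, cotKernel τ n m / ((n : ℂ) + 1) ^ 2)
      (∑' p : ℕ × ℕ, cotKernel τ p.1 p.2 / ((p.1 : ℂ) + 1) ^ 2) :=
    hs.hasSum.prod_fiberwise fun n ↦ (hs.prod_factor n).hasSum
  refine (hasSum_F₃_succ hτ).unique ?_
  convert! (hasSum_one_div_add_one_cube.mul_left (-1 / 2)).add
    (((hasSum_one_div_add_one_pow_four.div_const τ).add (h1.mul_left (2 * τ))).mul_left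
      (Complex.I / (2 * π))) using 1
  · ext n
    have hn : ((n : ℂ) + 1) ≠ 0 := Nat.cast_add_one_ne_zero n
    have him : 0 < (((n : ℂ) + 1) * τ).im := by
      have : (((n : ℂ) + 1) * τ).im = ((n : ℝ) + 1) * τ.im := by simp
      rw [this]
      positivity
    rw [lambertTerm_eq_cot_series him, tsum_div_const]
    simp only [cotKernel]
    field_simp
  · ring

/-- The behaviour of `F₃` under `τ ↦ -1/τ`. -/
lemma F₃_sub_sq_mul_F₃_neg_one_div {τ : ℂ} (hτ : 0 < τ.im) :
    F₃ τ - τ ^ 2 * F₃ (-1 / τ) = riemannZeta 3 / 2 * (τ ^ 2 - 1) +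
      Complex.I * π ^ 3 / 180 * (1 / τ + τ ^ 3 - 5 * τ) := by
  have h0 : τ ≠ 0 := fun h ↦ by simp [h] at hτ
  have hpi : (π : ℂ) ≠ 0 := by exact_mod_cast Real.pi_ne_zero
  have hA := summable_cotKernel_div_fst hτ
  have hB := summable_cotKernel_div_snd hτ
  have hswap : ∑' p : ℕ × ℕ, cotKernel (-1 / τ) p.1 p.2 / ((p.1 : ℂ) + 1) ^ 2 =
      -τ ^ 2 * ∑' p : ℕ × ℕ, cotKernel τ p.1 p.2 / ((p.2 : ℂ) + 1) ^ 2 := by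
    rw [← tsum_mul_left, ← (Equiv.prodComm ℕ ℕ).tsum_eq]
    refine tsum_congr fun p ↦ ?_
    simp only [Equiv.prodComm_apply, Prod.fst_swap, Prod.snd_swap, cotKernel_neg_one_div hτ]
    ring
  have hAB : ∑' p : ℕ × ℕ, cotKernel τ p.1 p.2 / ((p.1 : ℂ) + 1) ^ 2 -
      τ ^ 2 * ∑' p : ℕ × ℕ, cotKernel τ p.1 p.2 / ((p.2 : ℂ) + 1) ^ 2 =
      -((π : ℂ) ^ 2 / 6) ^ 2 := by
    have h2 := hasSum_one_div_add_one_sq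
    have hn : Summable fun n : ℕ ↦ ‖1 / ((n : ℂ) + 1) ^ 2‖ := by
      simpa [norm_natCast_add_one] using summable_one_div_add_one_sq
    have hprod := tsum_mul_tsum_of_summable_norm hn hn
    rw [h2.tsum_eq] at hprod
    rw [sq ((π : ℂ) ^ 2 / 6), hprod, ← tsum_neg, ← tsum_mul_left,
      ← hA.tsum_sub (hB.mul_left _)]
    refine tsum_congr fun p ↦ ?_
    have hn : ((p.1 : ℂ) + 1) ≠ 0 := Nat.cast_add_one_ne_zero p.1
    have hm : ((p.2 : ℂ) + 1) ≠ 0 := Nat.cast_add_one_ne_zero p.2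
    have hne : (((p.1 : ℂ) + 1) * τ) ^ 2 - ((p.2 : ℂ) + 1) ^ 2 ≠ 0 := by
      have him : 0 < (((p.1 : ℂ) + 1) * τ).im := by
        have : (((p.1 : ℂ) + 1) * τ).im = ((p.1 : ℝ) + 1) * τ.im := by simp
        rw [this]
        positivity
      have := Complex.integerComplement_pow_two_ne_pow_two
        (UpperHalfPlane.coe_mem_integerComplement ⟨_, him⟩) (p.2 + 1)
      exact sub_ne_zero.mpr (by simpa using this)
    rw [cotKernel]
    generalize hd : (((p.1 : ℂ) + 1) * τ) ^ 2 - ((p.2 : ℂ) + 1) ^ 2 = d at hne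
    field_simp
    linear_combination -hd
  rw [F₃_eq_tsum_cotKernel hτ, F₃_eq_tsum_cotKernel (neg_one_div_im_pos hτ), hswap]
  generalize ∑' p : ℕ × ℕ, cotKernel τ p.1 p.2 / ((p.1 : ℂ) + 1) ^ 2 = A at hAB ⊢
  generalize ∑' p : ℕ × ℕ, cotKernel τ p.1 p.2 / ((p.2 : ℂ) + 1) ^ 2 = B at hAB ⊢
  obtain rfl : A = τ ^ 2 * B - ((π : ℂ) ^ 2 / 6) ^ 2 := by linear_combination hAB
  field_simp
  ring

/-- `F₃_sub_sq_mul_F₃_neg_one_div` with the translate of `-1/τ` left free. -/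
lemma F₃_eq_sq_mul_F₃_add {τ τ' : ℂ} (hτ : 0 < τ.im) (k : ℤ) (h : τ * (τ' + k) = -1) :
    F₃ τ = τ ^ 2 * F₃ τ' + riemannZeta 3 / 2 * (τ ^ 2 - 1) +
      Complex.I * π ^ 3 / 180 * (-(τ' + k) + τ ^ 3 - 5 * τ) := by
  have h0 : τ ≠ 0 := fun h ↦ by simp [h] at hτ
  have e : τ' + k = -1 / τ := by rw [eq_div_iff h0, mul_comm, h]
  have him : 0 < τ'.im := by
    have := neg_one_div_im_pos hτ
    rw [← e] at this
    simpa using this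
  have := F₃_sub_sq_mul_F₃_neg_one_div hτ
  rw [← e, F₃_add_intCast him] at this
  rw [sub_eq_iff_eq_add.mp this, e]
  ring

theorem F₃_value_d :
    24 * F₃ (Real.sqrt 15 * Complex.I / 6 + 1 / 2) -
          8 * F₃ (Real.sqrt 15 * Complex.I / 2 + 1 / 2) -
        3 * F₃ (Real.sqrt 15 * Complex.I / 3) + F₃ (Real.sqrt 15 * Complex.I) =
      ((Real.pi ^ 3 / Real.sqrt 15 : ℝ) : ℂ) - 7 * riemannZeta 3 := by
  have hpos : 0 < Real.sqrt 15 := by positivity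
  have hrhs : ((Real.pi ^ 3 / Real.sqrt 15 : ℝ) : ℂ) = π ^ 3 * (Real.sqrt 15 : ℂ) / 15 := by
    have : Real.pi ^ 3 / Real.sqrt 15 = Real.pi ^ 3 * Real.sqrt 15 / 15 := by
      rw [div_eq_div_iff hpos.ne' (by norm_num), mul_assoc, Real.mul_self_sqrt (by norm_num)]
    rw [this]
    push_cast
    rfl
  rw [hrhs]
  set t : ℂ := Real.sqrt 15 * Complex.I with ht
  have hI : Complex.I ^ 2 = -1 := Complex.I_sq
  have hs : ((Real.sqrt 15 : ℝ) : ℂ) ^ 2 = 15 := by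
    rw [← Complex.ofReal_pow, Real.sq_sqrt (by norm_num)]
    norm_num
  have ht2 : t ^ 2 = -15 := by rw [ht, mul_pow, hs, hI]; norm_num
  have hst : (Real.sqrt 15 : ℂ) = -Complex.I * t := by
    rw [ht]
    linear_combination (Real.sqrt 15 : ℂ) * hI
  have htim : t.im = Real.sqrt 15 := by simp [ht]
  have him : ∀ a b : ℝ, 0 < a → 0 < ((a : ℂ) * t + b).im := fun a b ha ↦ by
    rw [Complex.add_im, Complex.im_ofReal_mul, Complex.ofReal_im, htim]
    positivity
  clear_value t
  have hω : 0 < (t / 2 + 1 / 2).im := by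
    convert him (1 / 2) (1 / 2) (by norm_num) using 2; push_cast; ring
  have hx : 0 < (t / 6 + 1 / 2).im := by
    convert him (1 / 6) (1 / 2) (by norm_num) using 2; push_cast; ring
  have h4 : 0 < (t / 4 + -3 / 4).im := by
    convert him (1 / 4) (-3 / 4) (by norm_num) using 2; push_cast; ring
  have h4' : 0 < (t / 4 + 3 / 4).im := by
    convert him (1 / 4) (3 / 4) (by norm_num) using 2; push_cast; ring
  have h12 : 0 < (t / 12 + 1 / 4).im := by
    convert him (1 / 12) (1 / 4) (by norm_num) using 2; push_cast; ring
  have h12' : 0 < (t / 12 + -1 / 4).im := by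
    convert him (1 / 12) (-1 / 4) (by norm_num) using 2; push_cast; ring
  have ht0 : 0 < t.im := by rw [htim]; exact hpos
  have ht3 : 0 < (t / 3).im := by
    convert him (1 / 3) 0 (by norm_num) using 2; push_cast; ring
  have hecke₁ := F₃_half_add_F₃_half hω
  have hecke₂ := F₃_half_add_F₃_half hx
  rw [show 2 * (t / 2 + 1 / 2) = t + (1 : ℤ) by push_cast; ring, F₃_add_intCast ht0,
    show (t / 2 + 1 / 2) / 2 + 1 / 2 = t / 4 + 3 / 4 by ring,
    show (t / 2 + 1 / 2) / 2 = t / 4 + -3 / 4 + (1 : ℤ) by push_cast; ring,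
    F₃_add_intCast h4] at hecke₁
  rw [show 2 * (t / 6 + 1 / 2) = t / 3 + (1 : ℤ) by push_cast; ring, F₃_add_intCast ht3,
    show (t / 6 + 1 / 2) / 2 = t / 12 + 1 / 4 by ring,
    show t / 12 + 1 / 4 + 1 / 2 = t / 12 + -1 / 4 + (1 : ℤ) by push_cast; ring,
    F₃_add_intCast h12'] at hecke₂
  have r₁ := F₃_eq_sq_mul_F₃_add (τ' := t / 6 + 1 / 2) h4 0
    (by push_cast; linear_combination ht2 / 24)
  have r₂ := F₃_eq_sq_mul_F₃_add (τ' := t / 6 + 1 / 2) h4' (-1)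
    (by push_cast; linear_combination ht2 / 24)
  have r₃ := F₃_eq_sq_mul_F₃_add (τ' := t / 2 + 1 / 2) h12 (-2)
    (by push_cast; linear_combination ht2 / 24)
  have r₄ := F₃_eq_sq_mul_F₃_add (τ' := t / 2 + 1 / 2) h12' 1
    (by push_cast; linear_combination ht2 / 24)
  rw [r₁, r₂] at hecke₁
  rw [r₃, r₄] at hecke₂
  have ht3' : t ^ 3 = -15 * t := by rw [pow_succ, ht2]
  rw [hst]
  push_cast at hecke₁ hecke₂
  ring_nf at hecke₁ hecke₂ ⊢
  simp only [ht2, ht3'] at hecke₁ hecke₂ ⊢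
  linear_combination 4 * hecke₁ - 12 * hecke₂
end

section
/- With ψ as defined, Σ_{m≥1} Σ_{n≥1} (ψ(n)/n²)·( 1/(24m² − 6mn + n²) + 1/(24m² + 6mn + n²) ) = 11·ζ(4) = 11π⁴/90, the double sum being absolutely convergent (note 24m² ± 6mn + n² = (n ± 3m)² + 15m² > 0 for m ≥ 1). -/
/-- The 6-periodic function `ψ` with `ψ(0) = -5760`, `ψ(±1) = -48`, `ψ(±2) = 720`, `ψ(3) = 384`. -/
def psi (n : ℤ) : ℤ :=
  if n % 6 = 0 then -5760
  else if n % 6 = 1 ∨ n % 6 = 5 then -48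
  else if n % 6 = 2 ∨ n % 6 = 4 then 720
  else 384

/-- The general term `1 / (n² Q(m, n))`, where `Q(m, n) = a m² + b m n + c n²`. -/
noncomputable def latticeTerm (a b c : ℝ) (p : ℤ × ℤ) : ℝ :=
  1 / ((p.2 : ℝ) ^ 2 * (a * (p.1 : ℝ) ^ 2 + b * p.1 * p.2 + c * (p.2 : ℝ) ^ 2))

/-- The sum of `1 / (n² Q(m, n))` over all `(m, n)` with `n ≠ 0`. -/
noncomputable def latticeSum (a b c : ℝ) : ℝ := ∑' p, latticeTerm a b c p

theorem HasSum.of_eq_fun {β : Type*} {f g : β → ℝ} {s : ℝ} (hg : HasSum g s)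
    (h : ∀ b, f b = g b) : HasSum f s :=
  funext h ▸ hg

theorem hasSum_ite_of_injective {ι β : Type*} {g : ι → β} (hg : Function.Injective g)
    {P : β → Prop} [DecidablePred P] (hP : ∀ p, P p ↔ ∃ i, g i = p) {f : β → ℝ} {s : ℝ}
    (h : HasSum (fun i => f (g i)) s) : HasSum (fun p => if P p then f p else 0) s := by
  rw [← hg.hasSum_iff]
  · convert h using 2 with i
    exact if_pos ((hP _).2 ⟨i, rfl⟩)
  · intro p hp
    exact if_neg fun h => hp ((hP p).1 h)

theorem hasSum_int_of_even {f : ℤ → ℝ} (hf : ∀ n, f (-n) = f n) (h0 : f 0 = 0) {s : ℝ}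
    (h : HasSum (fun n : ℕ => f n) s) : HasSum f (2 * s) := by
  have h' : HasSum (fun n : ℕ => f (-n)) s := by simpa only [hf] using h
  have h2 := h.of_nat_of_neg h'
  rwa [h0, sub_zero, ← two_mul] at h2

theorem hasSum_int_one_div_sq : HasSum (fun n : ℤ => 1 / (n : ℝ) ^ 2) (Real.pi ^ 2 / 3) := by
  rw [show Real.pi ^ 2 / 3 = 2 * (Real.pi ^ 2 / 6) by ring]
  exact hasSum_int_of_even (by simp) (by simp) (by simpa using hasSum_zeta_two)

theorem hasSum_int_one_div_pow_four :
    HasSum (fun n : ℤ => 1 / (n : ℝ) ^ 4) (Real.pi ^ 4 / 45) := by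
  rw [show Real.pi ^ 4 / 45 = 2 * (Real.pi ^ 4 / 90) by ring]
  exact hasSum_int_of_even (by intro n; push_cast; rw [Even.neg_pow (by decide)]) (by simp)
    (by simpa using hasSum_zeta_four)

theorem hasSum_fst_eq_zero :
    HasSum (fun p : ℤ × ℤ => if p.1 = 0 then 1 / (p.2 : ℝ) ^ 4 else 0) (Real.pi ^ 4 / 45) := by
  refine hasSum_ite_of_injective (g := fun n : ℤ => ((0, n) : ℤ × ℤ)) ?_ ?_
    hasSum_int_one_div_pow_four
  · intro a b h; simpa using h
  · rintro ⟨m, n⟩; simp [eq_comm]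

theorem hasSum_snd_eq_zero :
    HasSum (fun p : ℤ × ℤ => if p.2 = 0 then 1 / (p.1 : ℝ) ^ 4 else 0) (Real.pi ^ 4 / 45) := by
  refine hasSum_ite_of_injective (g := fun n : ℤ => ((n, 0) : ℤ × ℤ)) ?_ ?_
    hasSum_int_one_div_pow_four
  · intro a b h; simpa using h
  · rintro ⟨m, n⟩; simp [eq_comm]

theorem hasSum_fst_add_snd_eq_zero :
    HasSum (fun p : ℤ × ℤ => if p.1 + p.2 = 0 then 1 / (p.2 : ℝ) ^ 4 else 0)
      (Real.pi ^ 4 / 45) := by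
  refine hasSum_ite_of_injective (g := fun n : ℤ => ((-n, n) : ℤ × ℤ)) ?_ ?_
    hasSum_int_one_div_pow_four
  · intro a b h; simpa using h
  · rintro ⟨m, n⟩
    simp only [Prod.mk.injEq]
    exact ⟨fun h => ⟨n, by omega, rfl⟩, fun ⟨k, h1, h2⟩ => by omega⟩

/-- `(m, n) ↦ (n, m + n)` -/
def sndAddEquiv : ℤ × ℤ ≃ ℤ × ℤ where
  toFun p := (p.2, p.1 + p.2)
  invFun p := (p.2 - p.1, p.1)
  left_inv p := by ext <;> simp
  right_inv p := by ext <;> simp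

/-- `(m, n) ↦ (m, m + n)` -/
def fstAddEquiv : ℤ × ℤ ≃ ℤ × ℤ where
  toFun p := (p.1, p.1 + p.2)
  invFun p := (p.1, p.2 - p.1)
  left_inv p := by ext <;> simp
  right_inv p := by ext <;> simp

/-- `(m, n) ↦ (m + n, n)` -/
def addSndEquiv : ℤ × ℤ ≃ ℤ × ℤ where
  toFun p := (p.1 + p.2, p.2)
  invFun p := (p.1 - p.2, p.2)
  left_inv p := by ext <;> simp
  right_inv p := by ext <;> simp

/-- `(m, n) ↦ (-m, n)` -/
def negFstEquiv : ℤ × ℤ ≃ ℤ × ℤ where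
  toFun p := (-p.1, p.2)
  invFun p := (-p.1, p.2)
  left_inv p := by ext <;> simp
  right_inv p := by ext <;> simp

theorem hasSum_one_div_sq_mul_sq :
    HasSum (fun p : ℤ × ℤ => 1 / ((p.1 : ℝ) ^ 2 * (p.2 : ℝ) ^ 2)) (Real.pi ^ 4 / 9) := by
  have h := hasSum_int_one_div_sq
  have h2 := h.mul h (h.summable.mul_of_nonneg h.summable
    (fun n => by positivity) (fun n => by positivity))
  rw [show Real.pi ^ 4 / 9 = Real.pi ^ 2 / 3 * (Real.pi ^ 2 / 3) by ring]
  exact h2.of_eq_fun fun p => by rw [div_mul_div_comm, one_mul]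

/-- The general term `1 / (n² m (m + n))` of Tornheim's double series. -/
noncomputable def tornheimTerm (p : ℤ × ℤ) : ℝ :=
  1 / ((p.2 : ℝ) ^ 2 * p.1 * (p.1 + p.2))

theorem summable_tornheimTerm : Summable tornheimTerm := by
  have h := hasSum_one_div_sq_mul_sq.summable
  have h2 := (sndAddEquiv.summable_iff).2 h
  refine Summable.of_norm_bounded (h.add h2) fun p => ?_
  obtain ⟨m, n⟩ := p
  simp only [tornheimTerm, sndAddEquiv, Equiv.coe_fn_mk, Function.comp_apply, Real.norm_eq_abs]
  push_cast
  have key : ∀ x y z : ℝ, |1 / (x ^ 2 * y * z)| ≤ 1 / (y ^ 2 * x ^ 2) + 1 / (x ^ 2 * z ^ 2) := by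
    intro x y z
    simp only [one_div, mul_inv, abs_mul, abs_inv, abs_pow, ← inv_pow]
    have h1 : 0 ≤ |x|⁻¹ ^ 2 := by positivity
    rw [← sq_abs (x⁻¹), ← sq_abs (y⁻¹), ← sq_abs (z⁻¹), abs_inv, abs_inv, abs_inv]
    nlinarith [mul_nonneg h1 (sq_nonneg (|y|⁻¹ - |z|⁻¹)),
      mul_nonneg h1 (sq_nonneg (|y|⁻¹ + |z|⁻¹))]
  exact key n m (m + n)

theorem hasSum_tornheimTerm : HasSum tornheimTerm (2 * (Real.pi ^ 4 / 45)) := by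
  have hu := hasSum_one_div_sq_mul_sq
  have hw := summable_tornheimTerm.hasSum
  have h1 := ((hu.add (sndAddEquiv.hasSum_iff.2 hu)).add (fstAddEquiv.hasSum_iff.2 hu)).sub
    (((hw.add ((Equiv.prodComm ℤ ℤ).hasSum_iff.2 hw)).add
      ((fstAddEquiv.trans negFstEquiv).hasSum_iff.2 hw)).mul_left 2)
  have h2 := (hasSum_fst_eq_zero.add hasSum_snd_eq_zero).add hasSum_fst_add_snd_eq_zero
  have h3 := h1.unique (h2.of_eq_fun fun p => ?_)
  · have h4 : ∑' p, tornheimTerm p = 2 * (Real.pi ^ 4 / 45) := by linarith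
    exact h4 ▸ hw
  · obtain ⟨m, n⟩ := p
    simp only [tornheimTerm, sndAddEquiv, fstAddEquiv, negFstEquiv, Equiv.coe_fn_mk,
      Function.comp_apply, Equiv.coe_trans, Equiv.prodComm_apply, Prod.swap_prod_mk]
    by_cases hm : m = 0
    · by_cases hn : n = 0
      · simp [hm, hn]
      · simp [hm, hn]; field_simp
    by_cases hn : n = 0
    · simp [hm, hn]; field_simp
    by_cases hz : m + n = 0
    · obtain rfl : m = -n := by omega
      simp [hn]; field_simp
    have hm' : (m : ℝ) ≠ 0 := by exact_mod_cast hm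
    have hn' : (n : ℝ) ≠ 0 := by exact_mod_cast hn
    have hz' : (m : ℝ) + n ≠ 0 := by exact_mod_cast hz
    have hz2 : (n : ℝ) + m ≠ 0 := by rwa [add_comm]
    rw [if_neg hm, if_neg hn, if_neg hz]
    push_cast
    rw [add_comm (n : ℝ) m, neg_add_cancel_left]
    field_simp
    ring

theorem latticeTerm_le {a b c : ℝ} (hc : 0 < c) (hd : b ^ 2 < 4 * a * c) (p : ℤ × ℤ) :
    0 ≤ latticeTerm a b c p ∧ latticeTerm a b c p ≤
      4 * c / (4 * a * c - b ^ 2) * (1 / ((p.1 : ℝ) ^ 2 * (p.2 : ℝ) ^ 2)) +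
        1 / c * (if p.1 = 0 then 1 / (p.2 : ℝ) ^ 4 else 0) := by
  obtain ⟨m, n⟩ := p
  have hd' : 0 < 4 * a * c - b ^ 2 := by linarith
  simp only [latticeTerm]
  by_cases hm : m = 0
  · simp only [hm, Int.cast_zero]
    norm_num
    exact ⟨by positivity, le_of_eq (by ring)⟩
  by_cases hn : n = 0
  · simp [hn, hm]
  have hm' : (m : ℝ) ≠ 0 := by exact_mod_cast hm
  have hn' : (n : ℝ) ≠ 0 := by exact_mod_cast hn
  have hq : (4 * a * c - b ^ 2) / (4 * c) * (m : ℝ) ^ 2 ≤ a * m ^ 2 + b * m * n + c * n ^ 2 := by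
    rw [div_mul_eq_mul_div, div_le_iff₀ (by positivity)]
    nlinarith [sq_nonneg (2 * c * n + b * m)]
  have hpos : 0 < (4 * a * c - b ^ 2) / (4 * c) * (m : ℝ) ^ 2 := by positivity
  have hpos2 := hpos.trans_le hq
  refine ⟨by positivity, ?_⟩
  rw [if_neg hm, mul_zero, add_zero]
  calc _ ≤ 1 / ((n : ℝ) ^ 2 * ((4 * a * c - b ^ 2) / (4 * c) * (m : ℝ) ^ 2)) := by gcongr
    _ = _ := by field_simp

theorem summable_latticeTerm {a b c : ℝ} (hc : 0 < c) (hd : b ^ 2 < 4 * a * c) :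
    Summable (latticeTerm a b c) :=
  Summable.of_nonneg_of_le (fun p => (latticeTerm_le hc hd p).1)
    (fun p => (latticeTerm_le hc hd p).2)
    ((hasSum_one_div_sq_mul_sq.summable.mul_left _).add (hasSum_fst_eq_zero.summable.mul_left _))

theorem hasSum_latticeTerm {a b c : ℝ} (hc : 0 < c) (hd : b ^ 2 < 4 * a * c) :
    HasSum (latticeTerm a b c) (latticeSum a b c) :=
  (summable_latticeTerm hc hd).hasSum

theorem latticeSum_neg (a b c : ℝ) : latticeSum a (-b) c = latticeSum a b c := by
  rw [latticeSum, ← negFstEquiv.tsum_eq, latticeSum]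
  refine tsum_congr fun p => ?_
  simp [latticeTerm, negFstEquiv]

theorem latticeSum_shift (a b c : ℝ) :
    latticeSum a (b + 2 * a) (a + b + c) = latticeSum a b c := by
  rw [latticeSum, latticeSum, ← addSndEquiv.tsum_eq (latticeTerm a b c)]
  refine tsum_congr fun p => ?_
  simp only [latticeTerm, addSndEquiv, Equiv.coe_fn_mk]
  push_cast
  congr 2
  ring

theorem latticeSum_smul (k a b c : ℝ) :
    latticeSum (k * a) (k * b) (k * c) = 1 / k * latticeSum a b c := by
  rw [latticeSum, latticeSum, ← tsum_mul_left]
  refine tsum_congr fun p => ?_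
  rw [latticeTerm, latticeTerm, ← one_div_mul_one_div_rev, ← one_div_mul_one_div_rev,
    mul_left_comm, ← mul_assoc, one_div_mul_one_div_rev, one_div_mul_one_div_rev,
    one_div_mul_one_div_rev]
  congr 1
  ring

/-- The partial fraction relation between the sums attached to the linear forms
`n`, `m` and `m + n`. -/
theorem latticeSum_three_term {a b c : ℝ} (ha : 0 < a) (hc : 0 < c) (hd : b ^ 2 < 4 * a * c) :
    a ^ 2 * (b - 2 * c) * latticeSum a b c + c ^ 2 * (b - 2 * a) * latticeSum c b a -
        b * (b - a - c) ^ 2 * latticeSum (a - b + c) (b - 2 * a) a =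
      (2 * (a * (b - 2 * c) + c * (b - 2 * a) + b * (b - a - c)) +
        (a ^ 2 * (b - 2 * c) - b * (b - a - c) ^ 2) / c +
        (c ^ 2 * (b - 2 * a) - b * (b - a - c) ^ 2) / a +
        (a ^ 2 * (b - 2 * c) + c ^ 2 * (b - 2 * a)) / (a - b + c)) * (Real.pi ^ 4 / 45) := by
  have hpos : 0 < a - b + c := by nlinarith [sq_nonneg (a - c), sq_nonneg (a + c - b)]
  have h1 := hasSum_latticeTerm hc hd
  have h2 := (Equiv.prodComm ℤ ℤ).hasSum_iff.2
    (hasSum_latticeTerm (a := c) (b := b) ha (by linarith))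
  have h3 := sndAddEquiv.hasSum_iff.2
    (hasSum_latticeTerm (a := a - b + c) (b := b - 2 * a) ha (by linarith))
  have hw := hasSum_tornheimTerm
  have hl := ((h1.mul_left (a ^ 2 * (b - 2 * c))).add (h2.mul_left (c ^ 2 * (b - 2 * a)))).sub
    (h3.mul_left (b * (b - a - c) ^ 2))
  have hr := (((((hw.mul_left (a * (b - 2 * c))).add
    (((Equiv.prodComm ℤ ℤ).hasSum_iff.2 hw).mul_left (c * (b - 2 * a)))).add
    (((fstAddEquiv.trans negFstEquiv).hasSum_iff.2 hw).mul_left (b * (b - a - c)))).add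
    (hasSum_fst_eq_zero.mul_left ((a ^ 2 * (b - 2 * c) - b * (b - a - c) ^ 2) / c))).add
    (hasSum_snd_eq_zero.mul_left ((c ^ 2 * (b - 2 * a) - b * (b - a - c) ^ 2) / a))).add
    (hasSum_fst_add_snd_eq_zero.mul_left
      ((a ^ 2 * (b - 2 * c) + c ^ 2 * (b - 2 * a)) / (a - b + c)))
  rw [hl.unique (hr.of_eq_fun fun p => ?_)]
  · ring
  · obtain ⟨m, n⟩ := p
    simp only [tornheimTerm, latticeTerm, sndAddEquiv, fstAddEquiv, negFstEquiv,
      Equiv.coe_fn_mk, Function.comp_apply, Equiv.coe_trans, Equiv.prodComm_apply,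
      Prod.swap_prod_mk]
    by_cases hm : m = 0
    · by_cases hn : n = 0
      · simp [hm, hn]
      · have hn' : (n : ℝ) ≠ 0 := by exact_mod_cast hn
        have e : (a - b + c) * (n : ℝ) ^ 2 + (b - 2 * a) * n * n + a * n ^ 2 = c * n ^ 2 := by
          ring
        simp [hm, hn, e]; field_simp
    by_cases hn : n = 0
    · have hm' : (m : ℝ) ≠ 0 := by exact_mod_cast hm
      simp [hm, hn]; field_simp
    by_cases hz : m + n = 0
    · obtain rfl : m = -n := by omega
      have hn' : (n : ℝ) ≠ 0 := by exact_mod_cast hn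
      have e : a * (n : ℝ) ^ 2 + -(b * n * n) + c * n ^ 2 = (a - b + c) * n ^ 2 := by ring
      have e' : c * (n : ℝ) ^ 2 + -(b * n * n) + a * n ^ 2 = (a - b + c) * n ^ 2 := by ring
      simp [hn, e, e']; field_simp
    have hm' : (m : ℝ) ≠ 0 := by exact_mod_cast hm
    have hn' : (n : ℝ) ≠ 0 := by exact_mod_cast hn
    have hz' : (m : ℝ) + n ≠ 0 := by exact_mod_cast hz
    rw [if_neg hm, if_neg hn, if_neg hz]
    push_cast
    have hq : 0 < a * (m : ℝ) ^ 2 + b * m * n + c * n ^ 2 := by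
      have : 0 < (n : ℝ) ^ 2 := by positivity
      nlinarith [sq_nonneg (2 * a * m + b * n), mul_pos (sub_pos.2 hd) this]
    rw [show c * (n : ℝ) ^ 2 + b * n * m + a * m ^ 2 = a * m ^ 2 + b * m * n + c * n ^ 2 by ring,
      show (a - b + c) * (n : ℝ) ^ 2 + (b - 2 * a) * n * (m + n) + a * (m + n) ^ 2 =
        a * m ^ 2 + b * m * n + c * n ^ 2 by ring, add_comm (n : ℝ) m, neg_add_cancel_left]
    have hq' := hq.ne'
    generalize hQ : a * (m : ℝ) ^ 2 + b * m * n + c * n ^ 2 = Q at hq' ⊢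
    field_simp
    rw [← hQ]
    ring

theorem hasSum_ite_dvd_snd (d : ℤ) (h0 : d ≠ 0) {a b c : ℝ} (hc : 0 < c)
    (hd : b ^ 2 < 4 * a * c) :
    HasSum (fun p : ℤ × ℤ => if d ∣ p.2 then latticeTerm a b c p else 0)
      (1 / (d : ℝ) ^ 2 * latticeSum a (d * b) (d ^ 2 * c)) := by
  have h0' : 0 < (d : ℝ) ^ 2 := by positivity
  refine hasSum_ite_of_injective (g := fun p : ℤ × ℤ => (p.1, d * p.2)) ?_ ?_
    (((hasSum_latticeTerm (by positivity) (by nlinarith)).mul_left _).of_eq_fun ?_)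
  · rintro ⟨m, n⟩ ⟨m', n'⟩ h
    simpa [h0] using h
  · rintro ⟨m, n⟩
    simp [Dvd.dvd, eq_comm]
  · rintro ⟨m, n⟩
    simp only [latticeTerm]
    push_cast
    rw [one_div_mul_one_div]
    congr 1
    ring

/-- The Hecke relation at `2`. -/
theorem latticeSum_hecke_two {a b c : ℝ} (ha : 0 < a) (hc : 0 < c) (hd : b ^ 2 < 4 * a * c) :
    latticeSum (4 * a) (2 * b) c + 1 / 4 * latticeSum a (2 * b) (4 * c) +
      latticeSum (4 * a) (4 * a + 2 * b) (a + b + c) = 9 / 8 * latticeSum a b c := by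
  have hpos : 0 < a + b + c := by nlinarith [sq_nonneg (a - c), sq_nonneg (a + c + b)]
  have h1 : HasSum (fun p : ℤ × ℤ => if 2 ∣ p.1 then latticeTerm a b c p else 0)
      (latticeSum (4 * a) (2 * b) c) := by
    refine hasSum_ite_of_injective (g := fun p : ℤ × ℤ => (2 * p.1, p.2)) ?_ ?_
      ((hasSum_latticeTerm hc (by nlinarith)).of_eq_fun ?_)
    · rintro ⟨m, n⟩ ⟨m', n'⟩ h
      simpa using h
    · rintro ⟨m, n⟩
      simp [Dvd.dvd, eq_comm]
    · rintro ⟨m, n⟩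
      simp only [latticeTerm]
      push_cast
      congr 1
      ring
  have h2 := hasSum_ite_dvd_snd 2 (by norm_num) hc hd
  have h3 : HasSum (fun p : ℤ × ℤ => if 2 ∣ p.1 + p.2 then latticeTerm a b c p else 0)
      (latticeSum (4 * a) (4 * a + 2 * b) (a + b + c)) := by
    refine hasSum_ite_of_injective (g := fun p : ℤ × ℤ => (2 * p.1 + p.2, p.2)) ?_ ?_
      ((hasSum_latticeTerm hpos (by nlinarith)).of_eq_fun ?_)
    · rintro ⟨m, n⟩ ⟨m', n'⟩ h
      simp only [Prod.mk.injEq] at h ⊢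
      omega
    · rintro ⟨m, n⟩
      simp only [Prod.mk.injEq, Prod.exists]
      exact ⟨fun h => ⟨(m - n) / 2, n, by omega, rfl⟩, fun ⟨k, l, h, h'⟩ => by omega⟩
    · rintro ⟨m, n⟩
      simp only [latticeTerm]
      push_cast
      congr 1
      ring
  have h4 : HasSum (fun p : ℤ × ℤ => if 2 ∣ p.1 ∧ 2 ∣ p.2 then latticeTerm a b c p else 0)
      (1 / 16 * latticeSum a b c) := by
    refine hasSum_ite_of_injective (g := fun p : ℤ × ℤ => (2 * p.1, 2 * p.2)) ?_ ?_
      (((hasSum_latticeTerm hc hd).mul_left _).of_eq_fun ?_)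
    · rintro ⟨m, n⟩ ⟨m', n'⟩ h
      simpa using h
    · rintro ⟨m, n⟩
      simp [Dvd.dvd, eq_comm]
    · rintro ⟨m, n⟩
      simp only [latticeTerm]
      push_cast
      rw [one_div_mul_one_div]
      congr 1
      ring
  have key := ((h1.add h2).add h3).unique
    (((hasSum_latticeTerm hc hd).add (h4.mul_left 2)).of_eq_fun fun p => ?_)
  · norm_num at key ⊢
    linarith
  · rcases Int.even_or_odd' p.1 with ⟨k, hk | hk⟩ <;> rcases Int.even_or_odd' p.2 with ⟨l, hl | hl⟩
    · rw [if_pos (by omega), if_pos (by omega), if_pos (by omega), if_pos (by omega)]; ring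
    · rw [if_pos (by omega), if_neg (by omega), if_neg (by omega), if_neg (by omega)]; ring
    · rw [if_neg (by omega), if_pos (by omega), if_neg (by omega), if_neg (by omega)]; ring
    · rw [if_neg (by omega), if_neg (by omega), if_pos (by omega), if_neg (by omega)]; ring

theorem psi_neg (n : ℤ) : psi (-n) = psi n := by
  unfold psi
  split_ifs <;> first | rfl | omega

theorem psi_mul (n : ℤ) (x : ℝ) :
    (psi n : ℝ) * x = -48 * x + 768 * (if 2 ∣ n then x else 0) + 432 * (if 3 ∣ n then x else 0) -
      6912 * (if 6 ∣ n then x else 0) := by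
  unfold psi
  split_ifs <;> first | (exfalso; omega) | (push_cast; ring)

theorem hasSum_ite_dvd_one_div_pow_four (d : ℤ) (h0 : d ≠ 0) :
    HasSum (fun n : ℤ => if d ∣ n then 1 / (n : ℝ) ^ 4 else 0)
      (1 / (d : ℝ) ^ 4 * (Real.pi ^ 4 / 45)) := by
  refine hasSum_ite_of_injective (g := fun n : ℤ => d * n) ?_ ?_
    ((hasSum_int_one_div_pow_four.mul_left _).of_eq_fun ?_)
  · intro m n h
    simpa [h0] using h
  · intro n
    simp [Dvd.dvd, eq_comm]
  · intro n
    push_cast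
    rw [one_div_mul_one_div, mul_pow]

theorem hasSum_psi_div_pow_four :
    HasSum (fun n : ℤ => (psi n : ℝ) * (1 / (n : ℝ) ^ 4)) 0 := by
  have h := (((hasSum_int_one_div_pow_four.mul_left (-48)).add
    ((hasSum_ite_dvd_one_div_pow_four 2 (by norm_num)).mul_left 768)).add
    ((hasSum_ite_dvd_one_div_pow_four 3 (by norm_num)).mul_left 432)).sub
    ((hasSum_ite_dvd_one_div_pow_four 6 (by norm_num)).mul_left 6912)
  convert h.of_eq_fun fun n => psi_mul n _ using 1
  push_cast
  ring

theorem hasSum_psi_mul_latticeTerm :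
    HasSum (fun p : ℤ × ℤ => (psi p.2 : ℝ) * latticeTerm 24 6 1 p)
      (-48 * latticeSum 24 6 1 + 48 * latticeSum 6 3 1 + 16 * latticeSum 8 6 3 -
        16 * latticeSum 2 3 3) := by
  have h0 : (6 : ℝ) ^ 2 < 4 * 24 * 1 := by norm_num
  have h := ((((hasSum_latticeTerm one_pos h0).mul_left (-48)).add
    ((hasSum_ite_dvd_snd 2 (by norm_num) one_pos h0).mul_left 768)).add
    ((hasSum_ite_dvd_snd 3 (by norm_num) one_pos h0).mul_left 432)).sub
    ((hasSum_ite_dvd_snd 6 (by norm_num) one_pos h0).mul_left 6912)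
  have h2 := latticeSum_smul 4 6 3 1
  have h3 := latticeSum_smul 3 8 6 3
  have h6 := latticeSum_smul 12 2 3 3
  convert h.of_eq_fun fun p => psi_mul p.2 _ using 1
  norm_num at h2 h3 h6 ⊢
  rw [h2, h3, h6]
  ring

theorem latticeSum_combination :
    -48 * latticeSum 24 6 1 + 48 * latticeSum 6 3 1 + 16 * latticeSum 8 6 3 -
      16 * latticeSum 2 3 3 = 11 * Real.pi ^ 4 / 45 := by
  have hecke₁ := latticeSum_hecke_two (a := 6) (b := 3) (c := 1) (by norm_num) (by norm_num)
    (by norm_num)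
  have hecke₂ := latticeSum_hecke_two (a := 2) (b := 3) (c := 3) (by norm_num) (by norm_num)
    (by norm_num)
  have smul₁ := latticeSum_smul 2 3 3 2
  have smul₂ := latticeSum_smul 2 12 15 5
  have smul₃ := latticeSum_smul 2 1 3 6
  have smul₄ := latticeSum_smul 2 4 7 4
  have shift₁ := latticeSum_shift 12 (-9) 2
  have shift₂ := latticeSum_shift 2 (-1) 2
  have shift₃ := latticeSum_shift 1 1 4
  have shift₄ := latticeSum_shift 6 (-9) 4
  have shift₅ := latticeSum_shift 2 1 2
  have shift₆ := latticeSum_shift 2 5 5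
  have neg₁ := latticeSum_neg 12 9 2
  have neg₂ := latticeSum_neg 4 1 1
  have neg₃ := latticeSum_neg 2 1 2
  have neg₄ := latticeSum_neg 1 1 4
  have neg₅ := latticeSum_neg 4 7 4
  have neg₆ := latticeSum_neg 3 3 2
  have neg₇ := latticeSum_neg 5 5 2
  have rel₁ := latticeSum_three_term (a := 4) (b := -1) (c := 1) (by norm_num) (by norm_num)
    (by norm_num)
  have rel₂ := latticeSum_three_term (a := 4) (b := 1) (c := 1) (by norm_num) (by norm_num)
    (by norm_num)
  have rel₃ := latticeSum_three_term (a := 2) (b := 1) (c := 2) (by norm_num) (by norm_num)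
    (by norm_num)
  have rel₄ := latticeSum_three_term (a := 2) (b := -1) (c := 2) (by norm_num) (by norm_num)
    (by norm_num)
  have rel₅ := latticeSum_three_term (a := 2) (b := 9) (c := 12) (by norm_num) (by norm_num)
    (by norm_num)
  norm_num at hecke₁ hecke₂ smul₁ smul₂ smul₃ smul₄ shift₁ shift₂ shift₃ shift₄ shift₅
  norm_num at shift₆ neg₁ neg₂ neg₃ neg₄ neg₅ neg₆ neg₇ rel₁ rel₂ rel₃ rel₄ rel₅
  linarith

/-- A sum over `ℤ × ℤ` of an even function vanishing on both axes is twice the sum over the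
upper two quadrants. -/
theorem hasSum_quadrants {H : ℤ × ℤ → ℝ} {s : ℝ} (hH : HasSum H (2 * s))
    (heven : ∀ m n, H (-m, -n) = H (m, n)) (h₁ : ∀ n, H (0, n) = 0) (h₂ : ∀ m, H (m, 0) = 0) :
    HasSum (fun p : ℕ × ℕ => H (-(p.1 + 1), p.2 + 1) + H (p.1 + 1, p.2 + 1)) s := by
  have inj₁ : Function.Injective fun p : ℕ × ℕ => (((p.1 : ℤ) + 1, (p.2 : ℤ) + 1) : ℤ × ℤ) := by
    rintro ⟨m, n⟩ ⟨m', n'⟩ h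
    simpa using h
  have inj₂ : Function.Injective
      fun p : ℕ × ℕ => ((-((p.1 : ℤ) + 1), (p.2 : ℤ) + 1) : ℤ × ℤ) := by
    rintro ⟨m, n⟩ ⟨m', n'⟩ h
    simp only [Prod.mk.injEq] at h ⊢
    omega
  have inj₃ : Function.Injective
      fun p : ℕ × ℕ => ((-((p.1 : ℤ) + 1), -((p.2 : ℤ) + 1)) : ℤ × ℤ) := by
    rintro ⟨m, n⟩ ⟨m', n'⟩ h
    simp only [Prod.mk.injEq] at h ⊢
    omega
  have inj₄ : Function.Injective
      fun p : ℕ × ℕ => (((p.1 : ℤ) + 1, -((p.2 : ℤ) + 1)) : ℤ × ℤ) := by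
    rintro ⟨m, n⟩ ⟨m', n'⟩ h
    simp only [Prod.mk.injEq] at h ⊢
    omega
  obtain ⟨t₁, s₁⟩ := hH.summable.comp_injective inj₁
  obtain ⟨t₂, s₂⟩ := hH.summable.comp_injective inj₂
  have q₁ := hasSum_ite_of_injective (P := fun p => 0 < p.1 ∧ 0 < p.2) inj₁ (by
    rintro ⟨m, n⟩
    simp only [Prod.mk.injEq, Prod.exists]
    exact ⟨fun h => ⟨(m - 1).toNat, (n - 1).toNat, by omega, by omega⟩,
      fun ⟨k, l, h, h'⟩ => by omega⟩) s₁
  have q₂ := hasSum_ite_of_injective (P := fun p => p.1 < 0 ∧ 0 < p.2) inj₂ (by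
    rintro ⟨m, n⟩
    simp only [Prod.mk.injEq, Prod.exists]
    exact ⟨fun h => ⟨(-m - 1).toNat, (n - 1).toNat, by omega, by omega⟩,
      fun ⟨k, l, h, h'⟩ => by omega⟩) s₂
  have q₃ := hasSum_ite_of_injective (P := fun p => p.1 < 0 ∧ p.2 < 0) inj₃ (by
    rintro ⟨m, n⟩
    simp only [Prod.mk.injEq, Prod.exists]
    exact ⟨fun h => ⟨(-m - 1).toNat, (-n - 1).toNat, by omega, by omega⟩,
      fun ⟨k, l, h, h'⟩ => by omega⟩) (s₁.of_eq_fun fun p => heven _ _)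
  have q₄ := hasSum_ite_of_injective (f := H) (P := fun p => 0 < p.1 ∧ p.2 < 0) inj₄ (by
    rintro ⟨m, n⟩
    simp only [Prod.mk.injEq, Prod.exists]
    exact ⟨fun h => ⟨(m - 1).toNat, (-n - 1).toNat, by omega, by omega⟩,
      fun ⟨k, l, h, h'⟩ => by omega⟩)
    (s₂.of_eq_fun fun p => by rw [← heven, neg_neg]; rfl)
  have key := hH.unique ((((q₁.add q₂).add q₃).add q₄).of_eq_fun ?_)
  · rw [show s = t₂ + t₁ by linarith]
    exact s₂.add s₁
  · rintro ⟨m, n⟩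
    rcases lt_trichotomy m 0 with hm | rfl | hm
    · rcases lt_trichotomy n 0 with hn | rfl | hn
      · simp [hm, hn, hm.not_gt, hn.not_gt]
      · simp [h₂]
      · simp [hm, hn, hm.not_gt, hn.not_gt]
    · simp [h₁]
    · rcases lt_trichotomy n 0 with hn | rfl | hn
      · simp [hm, hn, hm.not_gt, hn.not_gt]
      · simp [h₂]
      · simp [hm, hn, hm.not_gt, hn.not_gt]

theorem psi_double_sum_eq_11_zeta4 :
    Summable (fun p : ℕ × ℕ =>
      (psi ((p.2 : ℤ) + 1) : ℝ) / ((p.2 : ℝ) + 1) ^ 2 *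
        (1 / (24 * ((p.1 : ℝ) + 1) ^ 2 - 6 * ((p.1 : ℝ) + 1) * ((p.2 : ℝ) + 1) +
              ((p.2 : ℝ) + 1) ^ 2) +
          1 / (24 * ((p.1 : ℝ) + 1) ^ 2 + 6 * ((p.1 : ℝ) + 1) * ((p.2 : ℝ) + 1) +
              ((p.2 : ℝ) + 1) ^ 2))) ∧
    (∑' p : ℕ × ℕ,
      (psi ((p.2 : ℤ) + 1) : ℝ) / ((p.2 : ℝ) + 1) ^ 2 *
        (1 / (24 * ((p.1 : ℝ) + 1) ^ 2 - 6 * ((p.1 : ℝ) + 1) * ((p.2 : ℝ) + 1) +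
              ((p.2 : ℝ) + 1) ^ 2) +
          1 / (24 * ((p.1 : ℝ) + 1) ^ 2 + 6 * ((p.1 : ℝ) + 1) * ((p.2 : ℝ) + 1) +
              ((p.2 : ℝ) + 1) ^ 2))) = 11 * Real.pi ^ 4 / 90 := by
  have hline : HasSum (fun p : ℤ × ℤ => if p.1 = 0 then (psi p.2 : ℝ) * (1 / (p.2 : ℝ) ^ 4) else 0)
      0 := by
    refine hasSum_ite_of_injective (g := fun n : ℤ => ((0, n) : ℤ × ℤ)) ?_ ?_
      hasSum_psi_div_pow_four
    · intro a b h; simpa using h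
    · rintro ⟨m, n⟩; simp [eq_comm]
  have hall : HasSum
      (fun p : ℤ × ℤ => if p.1 = 0 then 0 else (psi p.2 : ℝ) * latticeTerm 24 6 1 p)
      (2 * (11 * Real.pi ^ 4 / 90)) := by
    have h := hasSum_psi_mul_latticeTerm.sub hline
    rw [latticeSum_combination, sub_zero,
      show 11 * Real.pi ^ 4 / 45 = 2 * (11 * Real.pi ^ 4 / 90) by ring] at h
    refine h.of_eq_fun ?_
    rintro ⟨m, n⟩
    by_cases hm : m = 0
    · simp only [hm, if_true, latticeTerm]
      rw [eq_comm, sub_eq_zero]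
      congr 2
      push_cast
      ring
    · simp [hm]
  have hquad := hasSum_quadrants hall (by simp [psi_neg, latticeTerm]) (by simp)
    (by simp [latticeTerm])
  suffices h : HasSum _ _ from ⟨h.summable, h.tsum_eq⟩
  refine hquad.of_eq_fun ?_
  rintro ⟨m, n⟩
  have hm : (m : ℤ) + 1 ≠ 0 := by omega
  have hm' : -((m : ℤ) + 1) ≠ 0 := by omega
  simp only [if_neg hm, if_neg hm', latticeTerm]
  push_cast
  rw [← mul_add, div_eq_mul_one_div, mul_assoc, mul_add, one_div_mul_one_div, one_div_mul_one_div]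
  ring_nf
end

section
/- With ψ as defined, −(1/96)·Σ_{m≥1} Σ_{n∈ℤ} (ψ(n)/m²)·1/(24m² + 6mn + n²) = π⁴/15 = 6·ζ(4), the double sum being absolutely convergent (note 24m² + 6mn + n² = (n + 3m)² + 15m² ≥ 15m² for m ≥ 1). -/
/-- The summand of the lattice sum of `1 / (m² (a m² + b m n + c n²))`. -/
noncomputable def quadTerm (a b c : ℝ) (p : ℤ × ℤ) : ℝ :=
  ((p.1 : ℝ) ^ 2 * (a * (p.1 : ℝ) ^ 2 + b * p.1 * p.2 + c * (p.2 : ℝ) ^ 2))⁻¹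

/-- The summand of the lattice sum of `1 / (m n (a m² + b m n + c n²))`. -/
noncomputable def mixedTerm (a b c : ℝ) (p : ℤ × ℤ) : ℝ :=
  ((p.1 : ℝ) * p.2 * (a * (p.1 : ℝ) ^ 2 + b * p.1 * p.2 + c * (p.2 : ℝ) ^ 2))⁻¹

/-- The lattice sum of `1 / (m² (a m² + b m n + c n²))` over all `(m, n)` with `m ≠ 0`. -/
noncomputable def quadSum (a b c : ℝ) : ℝ := ∑' p : ℤ × ℤ, quadTerm a b c p

/-- The lattice sum of `1 / (m n (a m² + b m n + c n²))` over all `(m, n)` with `m n ≠ 0`. -/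
noncomputable def mixedSum (a b c : ℝ) : ℝ := ∑' p : ℤ × ℤ, mixedTerm a b c p

theorem hasSum_congr {ι : Type*} {f g : ι → ℝ} {s t : ℝ} (h : HasSum f s)
    (hfg : ∀ i, f i = g i) (hst : s = t) : HasSum g t :=
  hst ▸ funext hfg ▸ h

theorem hasSum_unique_of_eq {ι : Type*} {f g : ι → ℝ} {s t : ℝ} (hf : HasSum f s)
    (hg : HasSum g t) (hfg : ∀ i, f i = g i) : s = t :=
  (hasSum_congr hf hfg rfl).unique hg

theorem hasSum_ite_of_range {ι κ : Type*} {φ : ι → κ} (hφ : Function.Injective φ)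
    {P : κ → Prop} [DecidablePred P] (hP : ∀ p, P p ↔ p ∈ Set.range φ) {f : κ → ℝ} {s : ℝ}
    (h : HasSum (fun i => f (φ i)) s) : HasSum (fun p => if P p then f p else 0) s := by
  refine (hφ.hasSum_iff (f := fun p => if P p then f p else 0) ?_).1 ?_
  · intro x hx
    simp [hP, hx]
  · convert h using 2 with i
    simp [hP]

theorem hasSum_int_inv_sq : HasSum (fun n : ℤ => ((n : ℝ) ^ 2)⁻¹) (Real.pi ^ 2 / 3) := by
  have h : HasSum (fun n : ℕ => ((n : ℝ) ^ 2)⁻¹) (Real.pi ^ 2 / 6) := by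
    simpa using hasSum_zeta_two
  have := HasSum.of_nat_of_neg (f := fun n : ℤ => ((n : ℝ) ^ 2)⁻¹) (by simpa using h)
    (by simpa using h)
  refine hasSum_congr this (fun _ => rfl) ?_
  norm_num
  ring

theorem hasSum_int_inv_pow_four :
    HasSum (fun n : ℤ => ((n : ℝ) ^ 4)⁻¹) (Real.pi ^ 4 / 45) := by
  have h : HasSum (fun n : ℕ => ((n : ℝ) ^ 4)⁻¹) (Real.pi ^ 4 / 90) := by
    simpa using hasSum_zeta_four
  have := HasSum.of_nat_of_neg (f := fun n : ℤ => ((n : ℝ) ^ 4)⁻¹) (by simpa using h)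
    (by simpa [Even.neg_pow (show Even 4 by decide)] using h)
  refine hasSum_congr this (fun _ => rfl) ?_
  norm_num
  ring

theorem hasSum_inv_sq_mul_sq :
    HasSum (fun p : ℤ × ℤ => ((p.1 : ℝ) ^ 2)⁻¹ * ((p.2 : ℝ) ^ 2)⁻¹) (Real.pi ^ 4 / 9) := by
  have h := hasSum_int_inv_sq
  exact hasSum_congr (h.mul h (h.summable.mul_of_nonneg h.summable (fun _ => by positivity)
    (fun _ => by positivity))) (fun _ => rfl) (by ring)

theorem hasSum_line (k : ℤ) :
    HasSum (fun p : ℤ × ℤ => if p.1 = k * p.2 then ((p.2 : ℝ) ^ 4)⁻¹ else 0)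
      (Real.pi ^ 4 / 45) :=
  hasSum_ite_of_range (φ := fun n : ℤ => (k * n, n)) (fun _ _ h => (Prod.ext_iff.1 h).2)
    (fun ⟨x, y⟩ => by simp [eq_comm]) (f := fun p : ℤ × ℤ => ((p.2 : ℝ) ^ 4)⁻¹)
    hasSum_int_inv_pow_four

theorem hasSum_axis :
    HasSum (fun p : ℤ × ℤ => if p.2 = 0 then ((p.1 : ℝ) ^ 4)⁻¹ else 0) (Real.pi ^ 4 / 45) :=
  hasSum_ite_of_range (φ := fun n : ℤ => (n, (0 : ℤ))) (fun _ _ h => (Prod.ext_iff.1 h).1)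
    (fun ⟨x, y⟩ => by simp [eq_comm]) (f := fun p : ℤ × ℤ => ((p.1 : ℝ) ^ 4)⁻¹)
    hasSum_int_inv_pow_four

theorem quadForm_pos {a b c : ℝ} (ha : 0 < a) (hd : b ^ 2 < 4 * a * c) {x y : ℝ}
    (h : x ≠ 0 ∨ y ≠ 0) : 0 < a * x ^ 2 + b * x * y + c * y ^ 2 := by
  have key : 4 * a * (a * x ^ 2 + b * x * y + c * y ^ 2) =
      (2 * a * x + b * y) ^ 2 + (4 * a * c - b ^ 2) * y ^ 2 := by ring
  have hpos : 0 < (2 * a * x + b * y) ^ 2 + (4 * a * c - b ^ 2) * y ^ 2 := by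
    by_cases hy : y = 0
    · have hx : x ≠ 0 := by tauto
      subst hy
      have : 2 * a * x ≠ 0 := by positivity
      simp only [mul_zero, add_zero]
      positivity
    · have : 0 < 4 * a * c - b ^ 2 := by linarith
      positivity
  rw [← key] at hpos
  exact pos_of_mul_pos_right hpos (by positivity)

theorem quadForm_lower (a b c x y : ℝ) :
    (4 * a * c - b ^ 2) * (x ^ 2 + y ^ 2) ≤
      4 * (a + c) * (a * x ^ 2 + b * x * y + c * y ^ 2) := by
  nlinarith [sq_nonneg (2 * a * x + b * y), sq_nonneg (b * x + 2 * c * y)]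

theorem summable_quadTerm {a b c : ℝ} (ha : 0 < a) (hd : b ^ 2 < 4 * a * c) :
    Summable (quadTerm a b c) := by
  have h1 : Summable (fun n : ℤ => ((n : ℝ) ^ 2)⁻¹ + if n = 0 then 1 else 0) :=
    hasSum_int_inv_sq.summable.add (hasSum_ite_eq (0 : ℤ) (1 : ℝ)).summable
  have h2 : Summable (fun p : ℤ × ℤ => ((p.1 : ℝ) ^ 2)⁻¹ *
      (((p.2 : ℝ) ^ 2)⁻¹ + if p.2 = 0 then 1 else 0)) :=
    hasSum_int_inv_sq.summable.mul_of_nonneg h1 (fun _ => by positivity)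
      (fun _ => by dsimp only [Pi.zero_apply]; split_ifs <;> positivity)
  have hδ : 0 < 4 * a * c - b ^ 2 := by linarith
  refine Summable.of_nonneg_of_le ?_ ?_
    (h2.mul_left (4 * (a + c) / (4 * a * c - b ^ 2)))
  · rintro ⟨m, n⟩
    by_cases hm : m = 0
    · simp [quadTerm, hm]
    · have := quadForm_pos ha hd (x := m) (y := n) (Or.inl (by exact_mod_cast hm))
      simp only [quadTerm]
      positivity
  · rintro ⟨m, n⟩
    by_cases hm : m = 0
    · simp [quadTerm, hm]
    have hm' : (m : ℝ) ≠ 0 := by exact_mod_cast hm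
    have hm1 : (1 : ℝ) ≤ (m : ℝ) ^ 2 := by
      have : 1 ≤ m ^ 2 := by
        have : 0 < m ^ 2 := by positivity
        omega
      exact_mod_cast this
    have hQ := quadForm_pos ha hd (x := m) (y := n) (Or.inl hm')
    have hlow := quadForm_lower a b c m n
    simp only [quadTerm, mul_inv]
    rw [mul_left_comm]
    refine mul_le_mul_of_nonneg_left ?_ (by positivity)
    have aux : ∀ t : ℝ, 0 < t → t ≤ (m : ℝ) ^ 2 + (n : ℝ) ^ 2 →
        (a * (m : ℝ) ^ 2 + b * m * n + c * (n : ℝ) ^ 2)⁻¹ ≤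
          4 * (a + c) / (4 * a * c - b ^ 2) * t⁻¹ := by
      intro t ht htm
      rw [← div_eq_mul_inv, div_div, inv_eq_one_div, div_le_div_iff₀ hQ (by positivity)]
      nlinarith [mul_le_mul_of_nonneg_left htm hδ.le]
    by_cases hn : n = 0
    · simpa [hn] using aux 1 one_pos (by simpa [hn] using hm1)
    · have hn' : (n : ℝ) ≠ 0 := by exact_mod_cast hn
      simpa [hn] using aux ((n : ℝ) ^ 2) (by positivity) (by nlinarith [sq_nonneg (m : ℝ)])

theorem hasSum_quadTerm {a b c : ℝ} (ha : 0 < a) (hd : b ^ 2 < 4 * a * c) :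
    HasSum (quadTerm a b c) (quadSum a b c) :=
  (summable_quadTerm ha hd).hasSum

theorem hasSum_quadTerm_swap {a b c : ℝ} (ha : 0 < a) (hd : b ^ 2 < 4 * a * c) :
    HasSum (fun p : ℤ × ℤ => quadTerm a b c p.swap) (quadSum a b c) :=
  (Equiv.prodComm ℤ ℤ).hasSum_iff.2 (hasSum_quadTerm ha hd)

theorem hasSum_mixedTerm {a b c : ℝ} (ha : 0 < a) (hc : 0 < c) (hd : b ^ 2 < 4 * a * c) :
    HasSum (mixedTerm a b c) (mixedSum a b c) := by
  refine Summable.hasSum (Summable.of_norm_bounded ((summable_quadTerm ha hd).add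
    (hasSum_quadTerm_swap hc (by linarith : b ^ 2 < 4 * c * a)).summable) ?_)
  rintro ⟨m, n⟩
  by_cases hm : m = 0
  · by_cases hn : n = 0
    · simp [mixedTerm, quadTerm, hm, hn]
    · simp only [mixedTerm, quadTerm, hm, Prod.swap]
      norm_num
      positivity
  by_cases hn : n = 0
  · simp only [mixedTerm, quadTerm, hn, Prod.swap]
    norm_num
    positivity
  have hm' : (m : ℝ) ≠ 0 := by exact_mod_cast hm
  have hn' : (n : ℝ) ≠ 0 := by exact_mod_cast hn
  have hQ := quadForm_pos ha hd (x := m) (y := n) (Or.inl hm')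
  have hQ' : c * (n : ℝ) ^ 2 + b * n * m + a * (m : ℝ) ^ 2 =
    a * (m : ℝ) ^ 2 + b * m * n + c * (n : ℝ) ^ 2 := by ring
  simp only [mixedTerm, quadTerm, Prod.swap, hQ']
  generalize a * (m : ℝ) ^ 2 + b * m * n + c * (n : ℝ) ^ 2 = Q at hQ
  rw [mul_inv, mul_inv, mul_inv, mul_inv, norm_mul, Real.norm_of_nonneg (inv_pos.2 hQ).le,
    ← add_mul]
  refine mul_le_mul_of_nonneg_right ?_ (inv_pos.2 hQ).le
  rw [Real.norm_eq_abs, abs_mul, ← inv_pow, ← inv_pow, ← sq_abs (m : ℝ)⁻¹, ← sq_abs (n : ℝ)⁻¹]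
  nlinarith [sq_nonneg (|(m : ℝ)⁻¹| - |(n : ℝ)⁻¹|), sq_nonneg |(m : ℝ)⁻¹|, sq_nonneg |(n : ℝ)⁻¹|]

theorem quadSum_smul {k : ℝ} (a b c : ℝ) :
    quadSum (k * a) (k * b) (k * c) = k⁻¹ * quadSum a b c := by
  rw [quadSum, quadSum, ← tsum_mul_left]
  refine tsum_congr fun p => ?_
  rw [quadTerm, quadTerm, ← mul_inv]
  congr 1
  ring

theorem quadSum_shift (k : ℤ) (a b c : ℝ) :
    quadSum (a + b * k + c * k ^ 2) (b + 2 * c * k) c = quadSum a b c := by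
  let e : ℤ × ℤ ≃ ℤ × ℤ :=
    ⟨fun p => (p.1, p.2 + k * p.1), fun p => (p.1, p.2 - k * p.1),
      fun p => by simp, fun p => by simp⟩
  rw [quadSum, quadSum, ← e.tsum_eq (quadTerm a b c)]
  refine tsum_congr fun p => ?_
  simp only [quadTerm, e, Equiv.coe_fn_mk]
  push_cast
  congr 1
  ring

theorem quadSum_neg (a b c : ℝ) : quadSum a (-b) c = quadSum a b c := by
  rw [quadSum, quadSum, ← ((Equiv.refl ℤ).prodCongr (Equiv.neg ℤ)).tsum_eq]
  refine tsum_congr fun p => ?_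
  simp only [quadTerm, Equiv.prodCongr_apply, Prod.map_fst, Prod.map_snd, Equiv.refl_apply,
    Equiv.neg_apply]
  push_cast
  congr 1
  ring

theorem hasSum_quadTerm_dvd {a b c : ℝ} (ha : 0 < a) (hd : b ^ 2 < 4 * a * c) {d : ℤ}
    (hd0 : d ≠ 0) :
    HasSum (fun p : ℤ × ℤ => if d ∣ p.2 then quadTerm a b c p else 0)
      (quadSum a (d * b) (d ^ 2 * c)) := by
  have hd0' : 0 < (d : ℝ) ^ 2 := by positivity
  refine hasSum_ite_of_range (φ := fun p : ℤ × ℤ => (p.1, d * p.2)) ?_ ?_ ?_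
  · rintro ⟨x, y⟩ ⟨x', y'⟩ h
    simpa [hd0] using h
  · rintro ⟨x, y⟩
    simp [Dvd.dvd, eq_comm]
  · refine hasSum_congr (hasSum_quadTerm (b := d * b) (c := d ^ 2 * c) ha (by nlinarith))
      (fun p => ?_) rfl
    simp only [quadTerm]
    push_cast
    congr 1
    ring

/-- The relation between a quadratic lattice sum and its restrictions to the three sublattices of
index two. -/
theorem quadSum_hecke_two {a b c : ℝ} (ha : 0 < a) (hd : b ^ 2 < 4 * a * c) :
    quadSum (4 * a) (2 * b) c / 4 + quadSum a (2 * b) (4 * c) +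
      quadSum (a + b + c) (2 * b + 4 * c) (4 * c) = 9 / 8 * quadSum a b c := by
  have hs := hasSum_quadTerm ha hd
  have h1 : HasSum (fun p : ℤ × ℤ => if 2 ∣ p.1 then quadTerm a b c p else 0)
      (4⁻¹ * quadSum (4 * a) (2 * b) c) := by
    refine hasSum_ite_of_range (φ := fun p : ℤ × ℤ => (2 * p.1, p.2)) ?_ ?_ ?_
    · rintro ⟨x, y⟩ ⟨x', y'⟩ h
      simpa using h
    · rintro ⟨x, y⟩
      simp [Dvd.dvd, eq_comm]
    · refine hasSum_congr ((hasSum_quadTerm (a := 4 * a) (b := 2 * b) (c := c) (by positivity)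
        (by linarith)).mul_left 4⁻¹) (fun p => ?_) rfl
      rw [quadTerm, quadTerm, ← mul_inv]
      push_cast
      congr 1
      ring
  have h2 : HasSum (fun p : ℤ × ℤ => if 2 ∣ p.2 then quadTerm a b c p else 0)
      (quadSum a (2 * b) (4 * c)) := by
    have := hasSum_quadTerm_dvd ha hd two_ne_zero
    norm_num at this
    exact this
  have h3 : HasSum (fun p : ℤ × ℤ => if 2 ∣ p.2 - p.1 then quadTerm a b c p else 0)
      (quadSum (a + b + c) (2 * b + 4 * c) (4 * c)) := by
    refine hasSum_ite_of_range (φ := fun p : ℤ × ℤ => (p.1, p.1 + 2 * p.2)) ?_ ?_ ?_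
    · rintro ⟨x, y⟩ ⟨x', y'⟩ h
      simp only [Prod.mk.injEq] at h ⊢
      omega
    · rintro ⟨x, y⟩
      simp only [Set.mem_range, Prod.mk.injEq, Prod.exists]
      constructor
      · rintro ⟨k, hk⟩
        exact ⟨x, k, rfl, by omega⟩
      · rintro ⟨x', k, rfl, rfl⟩
        exact ⟨k, by omega⟩
    · have hpos : 0 < a + b + c := by
        have := quadForm_pos ha hd (x := 1) (y := 1) (by simp)
        linarith
      refine hasSum_congr (hasSum_quadTerm hpos
        (by nlinarith : (2 * b + 4 * c) ^ 2 < 4 * (a + b + c) * (4 * c))) (fun p => ?_) rfl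
      simp only [quadTerm]
      push_cast
      congr 1
      ring
  have h4 : HasSum (fun p : ℤ × ℤ => if 2 ∣ p.1 ∧ 2 ∣ p.2 then quadTerm a b c p else 0)
      (16⁻¹ * quadSum a b c) := by
    refine hasSum_ite_of_range (φ := fun p : ℤ × ℤ => (2 * p.1, 2 * p.2)) ?_ ?_ ?_
    · rintro ⟨x, y⟩ ⟨x', y'⟩ h
      simpa using h
    · rintro ⟨x, y⟩
      simp [Dvd.dvd, eq_comm]
    · refine hasSum_congr (hs.mul_left 16⁻¹) (fun p => ?_) rfl
      rw [quadTerm, quadTerm, ← mul_inv]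
      push_cast
      congr 1
      ring
  have key := hasSum_unique_of_eq ((h1.add h2).add h3) (hs.add (h4.mul_left 2)) (by
    intro p
    by_cases hx : 2 ∣ p.1 <;> by_cases hy : 2 ∣ p.2
    · have : 2 ∣ p.2 - p.1 := by omega
      simp only [hx, hy, this, if_true, and_self]
      ring
    · have : ¬ 2 ∣ p.2 - p.1 := by omega
      simp [hx, hy, this]
    · have : ¬ 2 ∣ p.2 - p.1 := by omega
      simp [hx, hy, this]
    · have : 2 ∣ p.2 - p.1 := by omega
      simp [hx, hy, this])
  linarith

/-- The partial fraction relation obtained from `1 / (m² n²) = Q / (m² n² Q)`. -/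
theorem quadSum_partialFraction {a b c : ℝ} (ha : 0 < a) (hc : 0 < c) (hd : b ^ 2 < 4 * a * c) :
    a * quadSum c b a + c * quadSum a b c + b * mixedSum a b c =
      Real.pi ^ 4 / 9 + (c / a + a / c) * (Real.pi ^ 4 / 45) := by
  have hl := (((hasSum_quadTerm_swap hc (by linarith : b ^ 2 < 4 * c * a)).mul_left a).add
    ((hasSum_quadTerm ha hd).mul_left c)).add ((hasSum_mixedTerm ha hc hd).mul_left b)
  have hr := (hasSum_inv_sq_mul_sq.add (hasSum_axis.mul_left (c / a))).add
    ((hasSum_line 0).mul_left (a / c))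
  have key := hasSum_unique_of_eq hl hr (by
    rintro ⟨m, n⟩
    simp only [quadTerm, mixedTerm, Prod.swap, zero_mul]
    by_cases hm : m = 0
    · by_cases hn : n = 0
      · simp [hm, hn]
      · have hn' : (n : ℝ) ≠ 0 := by exact_mod_cast hn
        simp only [hm, hn, if_true, if_false, Int.cast_zero]
        field_simp
        simp
        ring
    · have hm' : (m : ℝ) ≠ 0 := by exact_mod_cast hm
      by_cases hn : n = 0
      · simp only [hm, hn, if_true, if_false, Int.cast_zero]
        field_simp
        simp
        ring
      · have hn' : (n : ℝ) ≠ 0 := by exact_mod_cast hn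
        have hQ := (quadForm_pos ha hd (x := m) (y := n) (Or.inl hm')).ne'
        have hQ' : c * (n : ℝ) ^ 2 + b * n * m + a * (m : ℝ) ^ 2 =
          a * (m : ℝ) ^ 2 + b * m * n + c * (n : ℝ) ^ 2 := by ring
        simp only [hm, hn, if_false, hQ']
        generalize hq : a * (m : ℝ) ^ 2 + b * m * n + c * (n : ℝ) ^ 2 = q at hQ
        field_simp
        linear_combination a * c * hq)
  linarith

/-- The relation obtained by summing `1 / (x y) + 1 / (x z) + 1 / (y z) = 0`, where
`x + y + z = 0`. -/
theorem mixedSum_cyclic {a b c : ℝ} (ha : 0 < a) (hc : 0 < c) (hd : b ^ 2 < 4 * a * c) :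
    mixedSum a b c + mixedSum (a - b + c) (2 * c - b) c + mixedSum (a - b + c) (2 * a - b) a =
      -(1 / c + 1 / a + 1 / (a - b + c)) * (Real.pi ^ 4 / 45) := by
  have he : 0 < a - b + c := by
    have := quadForm_pos ha hd (x := 1) (y := -1) (by simp)
    linarith
  let e₁ : ℤ × ℤ ≃ ℤ × ℤ := ⟨fun p => (p.1, -(p.1 + p.2)), fun p => (p.1, -(p.1 + p.2)),
    fun p => by simp, fun p => by simp⟩
  let e₂ : ℤ × ℤ ≃ ℤ × ℤ := ⟨fun p => (p.2, -(p.1 + p.2)), fun p => (-(p.1 + p.2), p.1),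
    fun p => by simp, fun p => by simp⟩
  have hl := ((hasSum_mixedTerm ha hc hd).add
    (e₁.hasSum_iff.2 (hasSum_mixedTerm (b := 2 * c - b) he hc (by nlinarith)))).add
    (e₂.hasSum_iff.2 (hasSum_mixedTerm (b := 2 * a - b) he ha (by nlinarith)))
  have hr := (((hasSum_line 0).mul_left (-(1 / c))).add (hasSum_axis.mul_left (-(1 / a)))).add
    ((hasSum_line (-1)).mul_left (-(1 / (a - b + c))))
  have key := hasSum_unique_of_eq hl hr (by
    rintro ⟨x, y⟩
    simp only [mixedTerm, Function.comp_apply, e₁, e₂, Equiv.coe_fn_mk, zero_mul]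
    push_cast
    have h₁ : (a - b + c) * (x : ℝ) ^ 2 + (2 * c - b) * x * -(x + y) + c * (-(x + y : ℝ)) ^ 2 =
      a * (x : ℝ) ^ 2 + b * x * y + c * (y : ℝ) ^ 2 := by ring
    have h₂ : (a - b + c) * (y : ℝ) ^ 2 + (2 * a - b) * y * -(x + y) + a * (-(x + y : ℝ)) ^ 2 =
      a * (x : ℝ) ^ 2 + b * x * y + c * (y : ℝ) ^ 2 := by ring
    rw [h₁, h₂]
    by_cases hx : x = 0
    · by_cases hy : y = 0
      · simp [hx, hy]
      · have hy' : (y : ℝ) ≠ 0 := by exact_mod_cast hy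
        simp [hx, hy]
        field_simp
    by_cases hy : y = 0
    · have hx' : (x : ℝ) ≠ 0 := by exact_mod_cast hx
      simp [hx, hy]
      field_simp
    have hx' : (x : ℝ) ≠ 0 := by exact_mod_cast hx
    have hy' : (y : ℝ) ≠ 0 := by exact_mod_cast hy
    by_cases hz : x = -1 * y
    · have hz' : (x : ℝ) = -y := by rw [hz]; push_cast; ring
      have hq : a * (-y : ℝ) ^ 2 + b * (-y) * y + c * (y : ℝ) ^ 2 =
        (a - b + c) * (y : ℝ) ^ 2 := by ring
      rw [if_neg hx, if_neg hy, if_pos hz, hz', hq, neg_add_cancel]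
      simp
      field_simp
    · have hz' : (x + y : ℝ) ≠ 0 := by
        have : x + y ≠ 0 := by omega
        exact_mod_cast this
      have hQ := (quadForm_pos ha hd (x := x) (y := y) (Or.inl hx')).ne'
      rw [if_neg hx, if_neg hy, if_neg hz]
      generalize a * (x : ℝ) ^ 2 + b * x * y + c * (y : ℝ) ^ 2 = q at hQ
      field_simp
      ring)
  linarith

theorem hasSum_inv_sq_mul_sq_dvd :
    HasSum (fun p : ℤ × ℤ => ((p.1 : ℝ) ^ 2)⁻¹ * (((p.1 : ℝ) + 3 * p.2) ^ 2)⁻¹)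
      (11 / 27 * (Real.pi ^ 4 / 9)) := by
  set f : ℤ × ℤ → ℝ := fun p => ((p.1 : ℝ) ^ 2)⁻¹ * ((p.2 : ℝ) ^ 2)⁻¹ with hf
  have hs : HasSum f (Real.pi ^ 4 / 9) := hasSum_inv_sq_mul_sq
  let φ : ℤ × ℤ → ℤ × ℤ := fun p => (p.1, p.1 + 3 * p.2)
  have hφ : Function.Injective φ := by
    rintro ⟨x, y⟩ ⟨x', y'⟩ h
    simp only [φ, Prod.mk.injEq] at h ⊢
    omega
  obtain ⟨T, hT⟩ := hs.summable.comp_injective hφ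
  have h1 : HasSum (fun p => if 3 ∣ p.2 - p.1 then f p else 0) T := by
    refine hasSum_ite_of_range hφ ?_ hT
    rintro ⟨x, y⟩
    simp only [φ, Set.mem_range, Prod.mk.injEq, Prod.exists]
    constructor
    · rintro ⟨k, hk⟩
      exact ⟨x, k, rfl, by omega⟩
    · rintro ⟨x', k, rfl, rfl⟩
      exact ⟨k, by omega⟩
  have h2 : HasSum (fun p => if 3 ∣ p.2 + p.1 then f p else 0) T := by
    refine hasSum_ite_of_range (φ := fun p : ℤ × ℤ => (p.1, -(p.1 + 3 * p.2))) ?_ ?_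
      (hasSum_congr hT (fun p => ?_) rfl)
    · rintro ⟨x, y⟩ ⟨x', y'⟩ h
      simp only [Prod.mk.injEq] at h ⊢
      omega
    · rintro ⟨x, y⟩
      simp only [Set.mem_range, Prod.mk.injEq, Prod.exists]
      constructor
      · rintro ⟨k, hk⟩
        exact ⟨x, -k, rfl, by omega⟩
      · rintro ⟨x', k, rfl, rfl⟩
        exact ⟨-k, by omega⟩
    · simp only [hf, φ, Function.comp_apply]
      push_cast
      rw [neg_sq]
  have h3 : HasSum (fun p => if 3 ∣ p.1 then f p else 0) (9⁻¹ * (Real.pi ^ 4 / 9)) := by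
    refine hasSum_ite_of_range (φ := fun p : ℤ × ℤ => (3 * p.1, p.2)) ?_ ?_
      (hasSum_congr (hs.mul_left 9⁻¹) (fun p => ?_) rfl)
    · rintro ⟨x, y⟩ ⟨x', y'⟩ h
      simpa using h
    · rintro ⟨x, y⟩
      simp [Dvd.dvd, eq_comm]
    · simp only [hf, ← mul_inv]
      push_cast
      congr 1
      ring
  have h4 : HasSum (fun p => if 3 ∣ p.2 then f p else 0) (9⁻¹ * (Real.pi ^ 4 / 9)) := by
    refine hasSum_ite_of_range (φ := fun p : ℤ × ℤ => (p.1, 3 * p.2)) ?_ ?_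
      (hasSum_congr (hs.mul_left 9⁻¹) (fun p => ?_) rfl)
    · rintro ⟨x, y⟩ ⟨x', y'⟩ h
      simpa using h
    · rintro ⟨x, y⟩
      simp [Dvd.dvd, eq_comm]
    · simp only [hf, ← mul_inv]
      push_cast
      congr 1
      ring
  have h5 : HasSum (fun p => if 3 ∣ p.1 ∧ 3 ∣ p.2 then f p else 0)
      (81⁻¹ * (Real.pi ^ 4 / 9)) := by
    refine hasSum_ite_of_range (φ := fun p : ℤ × ℤ => (3 * p.1, 3 * p.2)) ?_ ?_
      (hasSum_congr (hs.mul_left 81⁻¹) (fun p => ?_) rfl)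
    · rintro ⟨x, y⟩ ⟨x', y'⟩ h
      simpa using h
    · rintro ⟨x, y⟩
      simp [Dvd.dvd, eq_comm]
    · simp only [hf, ← mul_inv]
      push_cast
      congr 1
      ring
  have key := hasSum_unique_of_eq (((h1.add h2).add h3).add h4) (hs.add (h5.mul_left 3)) (by
    intro p
    by_cases hx : 3 ∣ p.1 <;> by_cases hy : 3 ∣ p.2
    · have hm : 3 ∣ p.2 - p.1 := by omega
      have hp : 3 ∣ p.2 + p.1 := by omega
      simp only [hx, hy, hm, hp, if_true, and_self]
      ring
    · have hm : ¬ 3 ∣ p.2 - p.1 := by omega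
      have hp : ¬ 3 ∣ p.2 + p.1 := by omega
      simp [hx, hy, hm, hp]
    · have hm : ¬ 3 ∣ p.2 - p.1 := by omega
      have hp : ¬ 3 ∣ p.2 + p.1 := by omega
      simp [hx, hy, hm, hp]
    · have hx' : p.1 % 3 = 1 ∨ p.1 % 3 = 2 := by omega
      have hy' : p.2 % 3 = 1 ∨ p.2 % 3 = 2 := by omega
      by_cases hm : 3 ∣ p.2 - p.1
      · have hp : ¬ 3 ∣ p.2 + p.1 := by omega
        simp [hx, hy, hm, hp]
      · have hp : 3 ∣ p.2 + p.1 := by omega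
        simp [hx, hy, hm, hp])
  refine hasSum_congr hT (fun p => ?_) (by linarith)
  simp [hf, φ]

/-- The relation obtained from the reflection `(x, n) ↦ (-(x + 3 n), n)` preserving the form
`x² + 3 x n + 6 n²`. -/
theorem quadSum_reflection :
    11 / 27 * (Real.pi ^ 4 / 9) + 10 / 27 * (Real.pi ^ 4 / 45) + 2 / 9 * mixedSum 1 3 6 =
      4 / 3 * quadSum 1 3 6 := by
  let e : ℤ × ℤ ≃ ℤ × ℤ := ⟨fun p => (-(p.1 + 3 * p.2), p.2), fun p => (-(p.1 + 3 * p.2), p.2),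
    fun p => by simp, fun p => by simp⟩
  have hd : (3 : ℝ) ^ 2 < 4 * 1 * 6 := by norm_num
  have hU := hasSum_quadTerm one_pos hd
  have hV := hasSum_mixedTerm one_pos (by norm_num) hd
  have hl := ((hasSum_inv_sq_mul_sq_dvd.add
    (((hasSum_line 0).add (hasSum_line (-3))).mul_left (1 / 54))).add
    (hasSum_axis.mul_left (1 / 3))).add ((hV.add (e.hasSum_iff.2 hV)).mul_left (1 / 9))
  have hr := ((e.hasSum_iff.2 hU).add hU).mul_left (2 / 3)
  have key := hasSum_unique_of_eq hl hr (by
    rintro ⟨x, n⟩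
    simp only [mixedTerm, quadTerm, Function.comp_apply, e, Equiv.coe_fn_mk, zero_mul]
    push_cast
    have h₁ : 1 * (-(x + 3 * n : ℝ)) ^ 2 + 3 * -(x + 3 * n : ℝ) * n + 6 * (n : ℝ) ^ 2 =
      1 * (x : ℝ) ^ 2 + 3 * x * n + 6 * (n : ℝ) ^ 2 := by ring
    rw [h₁]
    by_cases hx : x = 0
    · by_cases hn : n = 0
      · simp [hx, hn]
      · have hn' : (n : ℝ) ≠ 0 := by exact_mod_cast hn
        simp [hx, hn]
        field_simp
        norm_num
    have hx' : (x : ℝ) ≠ 0 := by exact_mod_cast hx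
    by_cases hn : n = 0
    · simp [hx, hn]
      field_simp
      norm_num
    have hn' : (n : ℝ) ≠ 0 := by exact_mod_cast hn
    by_cases hz : x = -3 * n
    · have hz' : (x : ℝ) = -3 * n := by rw [hz]; push_cast; ring
      have hq : 1 * (-3 * n : ℝ) ^ 2 + 3 * (-3 * n) * n + 6 * (n : ℝ) ^ 2 = 6 * (n : ℝ) ^ 2 := by
        ring
      have h0 : (-3 * n + 3 * n : ℝ) = 0 := by ring
      rw [if_neg hx, if_neg hn, if_pos hz, hz', hq, h0]
      simp
      field_simp
      norm_num
    · have hz' : (x + 3 * n : ℝ) ≠ 0 := by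
        have : x + 3 * n ≠ 0 := by omega
        exact_mod_cast this
      have hQ := (quadForm_pos one_pos hd (x := x) (y := n) (Or.inl hx')).ne'
      rw [if_neg hx, if_neg hn, if_neg hz]
      generalize hq : 1 * (x : ℝ) ^ 2 + 3 * x * n + 6 * (n : ℝ) ^ 2 = q at hQ
      field_simp
      linear_combination -1458 * n * hq)
  linarith

theorem quadSum_combination :
    quadSum 24 6 1 - 16 * quadSum 24 12 4 - 9 * quadSum 24 18 9 + 144 * quadSum 24 36 36 =
      4 * Real.pi ^ 4 / 15 := by
  have s₁ := quadSum_shift 1 4 1 1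
  have s₂ := quadSum_shift 1 2 (-1) 2
  have s₃ := quadSum_shift 1 1 (-3) 6
  rw [quadSum_neg] at s₂ s₃
  have k₁ := quadSum_smul (k := 4) 6 3 1
  have k₂ := quadSum_smul (k := 3) 8 6 3
  have k₃ := quadSum_smul (k := 12) 2 3 3
  have k₄ := quadSum_smul (k := 2) 2 1 2
  have k₅ := quadSum_smul (k := 2) 3 3 2
  have k₆ := quadSum_smul (k := 2) 1 3 6
  have k₇ := quadSum_smul (k := 2) 4 9 6
  have t₁ := quadSum_hecke_two (a := 4) (b := 1) (c := 1) (by norm_num) (by norm_num)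
  have t₂ := quadSum_hecke_two (a := 2) (b := 3) (c := 3) (by norm_num) (by norm_num)
  have r₁ := quadSum_partialFraction (a := 2) (b := 1) (c := 2)
    (by norm_num) (by norm_num) (by norm_num)
  have r₂ := quadSum_partialFraction (a := 3) (b := 3) (c := 2)
    (by norm_num) (by norm_num) (by norm_num)
  have r₃ := quadSum_partialFraction (a := 1) (b := 3) (c := 6)
    (by norm_num) (by norm_num) (by norm_num)
  have r₄ := quadSum_reflection
  have r₅ := mixedSum_cyclic (a := 2) (b := 1) (c := 2)
    (by norm_num) (by norm_num) (by norm_num)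
  have s₄ := quadSum_shift 2 16 2 1
  norm_num at *
  linarith

theorem psi_eq_dvd (n : ℤ) :
    (psi n : ℝ) = -48 * (1 - 16 * (if 2 ∣ n then 1 else 0) - 9 * (if 3 ∣ n then 1 else 0) +
      144 * (if 6 ∣ n then 1 else 0)) := by
  have h : n % 6 = 0 ∨ n % 6 = 1 ∨ n % 6 = 2 ∨ n % 6 = 3 ∨ n % 6 = 4 ∨ n % 6 = 5 := by omega
  have h2 : 2 ∣ n ↔ n % 6 = 0 ∨ n % 6 = 2 ∨ n % 6 = 4 := by omega
  have h3 : 3 ∣ n ↔ n % 6 = 0 ∨ n % 6 = 3 := by omega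
  have h6 : 6 ∣ n ↔ n % 6 = 0 := by omega
  simp only [psi, h2, h3, h6]
  rcases h with h | h | h | h | h | h <;> norm_num [h]

theorem hasSum_psi_mul_quadTerm :
    HasSum (fun p : ℤ × ℤ => (psi p.2 : ℝ) * quadTerm 24 6 1 p)
      (-48 * (4 * Real.pi ^ 4 / 15)) := by
  have ha : (0 : ℝ) < 24 := by norm_num
  have hd : (6 : ℝ) ^ 2 < 4 * 24 * 1 := by norm_num
  have h := ((((hasSum_quadTerm ha hd).sub
    ((hasSum_quadTerm_dvd ha hd (d := 2) (by norm_num)).mul_left 16)).sub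
    ((hasSum_quadTerm_dvd ha hd (d := 3) (by norm_num)).mul_left 9)).add
    ((hasSum_quadTerm_dvd ha hd (d := 6) (by norm_num)).mul_left 144)).mul_left (-48)
  refine hasSum_congr h (fun p => ?_) ?_
  · rw [psi_eq_dvd]
    split_ifs <;> ring
  · rw [← quadSum_combination]
    norm_num

theorem psi_double_sum_eq_6_zeta4 :
    Summable (fun p : ℕ × ℤ =>
      (psi p.2 : ℝ) / ((p.1 : ℝ) + 1) ^ 2 *
        (1 / (24 * ((p.1 : ℝ) + 1) ^ 2 + 6 * ((p.1 : ℝ) + 1) * (p.2 : ℝ) + (p.2 : ℝ) ^ 2))) ∧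
    -(1 / 96) * (∑' p : ℕ × ℤ,
      (psi p.2 : ℝ) / ((p.1 : ℝ) + 1) ^ 2 *
        (1 / (24 * ((p.1 : ℝ) + 1) ^ 2 + 6 * ((p.1 : ℝ) + 1) * (p.2 : ℝ) + (p.2 : ℝ) ^ 2))) =
      Real.pi ^ 4 / 15 := by
  have hfull := hasSum_psi_mul_quadTerm
  set g : ℤ × ℤ → ℝ := fun p => (psi p.2 : ℝ) * quadTerm 24 6 1 p with hg
  let φ : ℕ × ℤ → ℤ × ℤ := fun p => ((p.1 : ℤ) + 1, p.2)
  have hφ : Function.Injective φ := by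
    rintro ⟨x, y⟩ ⟨x', y'⟩ h
    simpa [φ] using h
  have hterm : (fun p : ℕ × ℤ => (psi p.2 : ℝ) / ((p.1 : ℝ) + 1) ^ 2 *
      (1 / (24 * ((p.1 : ℝ) + 1) ^ 2 + 6 * ((p.1 : ℝ) + 1) * (p.2 : ℝ) + (p.2 : ℝ) ^ 2))) =
      fun p => g (φ p) := by
    funext p
    simp only [hg, φ, quadTerm, mul_inv, div_eq_mul_inv, one_mul]
    push_cast
    ring
  have hsum : Summable (fun p => g (φ p)) := hfull.summable.comp_injective hφ
  obtain ⟨T, hT⟩ := hsum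
  have hpos : HasSum (fun p : ℤ × ℤ => if 0 < p.1 then g p else 0) T := by
    refine hasSum_ite_of_range hφ ?_ hT
    rintro ⟨x, y⟩
    simp only [φ, Set.mem_range, Prod.mk.injEq, Prod.exists]
    constructor
    · intro hx
      exact ⟨(x - 1).toNat, y, by omega, rfl⟩
    · rintro ⟨x', y', hx, -⟩
      omega
  have hneg := (Equiv.neg (ℤ × ℤ)).hasSum_iff.2 hpos
  have heven : ∀ p, g (-p) = g p := by
    intro p
    simp only [hg, quadTerm, psi_eq_dvd, Prod.fst_neg, Prod.snd_neg, dvd_neg]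
    push_cast
    ring_nf
  have key := hasSum_unique_of_eq (hpos.add hneg) hfull (by
    intro p
    simp only [Function.comp_apply, Equiv.neg_apply, heven, Prod.fst_neg]
    rcases lt_trichotomy p.1 0 with h | h | h
    · have h' : ¬ 0 < p.1 := by omega
      simp [h, h']
    · have hp : g p = 0 := by simp [hg, quadTerm, h]
      simp [hp]
    · have h' : ¬ p.1 < 0 := by omega
      simp [h, h'])
  rw [hterm]
  refine ⟨⟨T, hT⟩, ?_⟩
  rw [hT.tsum_eq]
  linarith
end
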